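/- Given a context-free ω-grammar G = (N, T, P, S, 𝓕), there can be constructed an ε-production-free context-free ω-grammar G' = (N', T, P', S, 𝓗), i.e., one with no productions of the form A → ε, such that L_{σ,ρ,π}(G) = L_{σ,ρ,π}(G') for every (σ,ρ,π) with σ ∈ {ran, inf}, ρ ∈ {⊓, ⊆, =}, π ∈ {l, nl}, and (σ,ρ,π) ∉ {(ran,⊓,l), (ran,=,l)}. -/

import Mathlib

namespace OmegaFormal

/-- σ component of an acceptance mode: `ran` (occurs at least once)
or `inf` (occurs infinitely often). -/
inductive AccSigma | ran | inf
deriving DecidableEq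

/-- ρ component of an acceptance mode: `cap` (nonempty intersection, ⊓),
`sub` (⊆) or `eq` (=). -/
inductive AccRho | cap | sub | eq
deriving DecidableEq

/-- derivation mode: leftmost (`l`) or normal (`nl`). -/
inductive DerivMode | l | nl
deriving DecidableEq

/-- `sigmaSet σ f` is ran(f) resp. inf(f). -/
def sigmaSet {Q : Type _} : AccSigma → (ℕ → Q) → Set Q
  | .ran, f => Set.range f
  | .inf, f => {q | ∀ n : ℕ, ∃ m : ℕ, n ≤ m ∧ f m = q}

/-- the binary relation denoted by ρ. -/
def rhoRel {Q : Type _} : AccRho → Set Q → Set Q → Prop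
  | .cap, A, B => (A ∩ B).Nonempty
  | .sub, A, B => A ⊆ B
  | .eq,  A, B => A = B

/-- f is (σ,ρ)-accepting w.r.t. the set 𝓕 of designated sets. -/
def IsAccepting {Q : Type _} (σ : AccSigma) (ρ : AccRho) (𝓕 : Set (Set Q)) (f : ℕ → Q) : Prop :=
  ∃ F ∈ 𝓕, rhoRel ρ (sigmaSet σ f) F

/-- the finite word `l` coincides with the prefix of the ω-word `u`. -/
def MatchesPrefix {T : Type _} (l : List T) (u : ℕ → T) : Prop :=
  ∀ (k : ℕ) (h : k < l.length), l.get ⟨k, h⟩ = u k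

/-- the maximal terminal prefix of a sentential form. -/
def termPrefix {N T : Type _} : List (N ⊕ T) → List T
  | [] => []
  | (Sum.inl _) :: _ => []
  | (Sum.inr a) :: l => a :: termPrefix l

/-- A phrase structure ω-grammar `G = (N, T, P, S, 𝓕)`:
`N` nonterminals, `T` terminals, `P` named productions `p : lhs p → rhs p`
with `lhs p ∈ N⁺`, `rhs p ∈ (N ∪ T)*`, start symbol, and
production repetition sets `acc ⊆ 2^P`. -/
structure OmegaPSG (T : Type) where
  N : Type
  [fintypeN : Fintype N]
  P : Type
  [fintypeP : Fintype P]
  lhs : P → List N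
  lhs_ne : ∀ p : P, lhs p ≠ []
  rhs : P → List (N ⊕ T)
  start : N
  acc : Set (Set P)

namespace OmegaPSG

variable {T : Type} (G : OmegaPSG T)

/-- one (normal) rewriting step using production p. -/
def Step (p : G.P) (x y : List (G.N ⊕ T)) : Prop :=
  ∃ u v : List (G.N ⊕ T),
    x = u ++ (G.lhs p).map Sum.inl ++ v ∧ y = u ++ G.rhs p ++ v

/-- one leftmost rewriting step: the rewritten occurrence starts at the
leftmost nonterminal, i.e. everything to its left is terminal. -/
def LStep (p : G.P) (x y : List (G.N ⊕ T)) : Prop :=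
  ∃ u v : List (G.N ⊕ T), (∀ s ∈ u, ∃ a : T, s = Sum.inr a) ∧
    x = u ++ (G.lhs p).map Sum.inl ++ v ∧ y = u ++ G.rhs p ++ v

def StepOf : DerivMode → G.P → List (G.N ⊕ T) → List (G.N ⊕ T) → Prop
  | .l => G.LStep
  | .nl => G.Step

/-- `L_{σ,ρ,π}(G)`: ω-words admitting an infinite π-derivation from S whose
growing terminal prefixes spell the word and whose production sequence is
(σ,ρ)-accepting w.r.t. `G.acc`. -/
def Lang (σ : AccSigma) (ρ : AccRho) (π : DerivMode) : Set (ℕ → T) :=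
  {u | ∃ (s : ℕ → List (G.N ⊕ T)) (d : ℕ → G.P),
    s 0 = [Sum.inl G.start] ∧
    (∀ i : ℕ, G.StepOf π (d i) (s i) (s (i + 1))) ∧
    (∀ n : ℕ, ∃ i : ℕ, n ≤ (termPrefix (s i)).length) ∧
    (∀ i : ℕ, MatchesPrefix (termPrefix (s i)) u) ∧
    IsAccepting σ ρ G.acc d}

/-- context-free: every left-hand side is a single nonterminal. -/
def IsCFG : Prop := ∀ p : G.P, (G.lhs p).length = 1

/-- context-sensitive (monotonic): `|β| ≥ |α|` for every production. -/
def IsCSG : Prop := ∀ p : G.P, (G.lhs p).length ≤ (G.rhs p).length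

/-- right linear: productions of the form `A → uB` or `A → u`, `u ∈ T*`. -/
def IsRLG : Prop :=
  ∀ p : G.P, (G.lhs p).length = 1 ∧
    ∃ (w : List T) (B : Option G.N),
      G.rhs p = w.map Sum.inr ++ B.toList.map Sum.inl

/-- `G` is a grammar with `$`-boundary (PSG version): with `$` = `dollar`,
`S` = `S'`, every production has one of the forms
(1) α → β, α,β ∈ N⁺ (N = nonterminals other than `$`, `S`),
(2) S → $α, α ∈ N⁺, (3) $A → a$, (4) A → ε. -/
def HasDollarBoundary (dollar S' : G.N) : Prop :=
  dollar ≠ S' ∧ G.start = S' ∧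
  ∀ p : G.P,
    ((dollar ∉ G.lhs p ∧ S' ∉ G.lhs p) ∧
      ∃ β : List G.N, β ≠ [] ∧ dollar ∉ β ∧ S' ∉ β ∧ G.rhs p = β.map Sum.inl) ∨
    (G.lhs p = [S'] ∧ ∃ α : List G.N, α ≠ [] ∧ dollar ∉ α ∧ S' ∉ α ∧
      G.rhs p = Sum.inl dollar :: α.map Sum.inl) ∨
    (∃ A : G.N, A ≠ dollar ∧ A ≠ S' ∧ G.lhs p = [dollar, A] ∧
      ∃ a : T, G.rhs p = [Sum.inr a, Sum.inl dollar]) ∨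
    (∃ A : G.N, A ≠ dollar ∧ A ≠ S' ∧ G.lhs p = [A] ∧ G.rhs p = [])

/-- `G` is a grammar with `$`-boundary (CSG version): forms (1)-(3) only,
with `|α| ≤ |β|` in form (1). -/
def HasDollarBoundaryCSG (dollar S' : G.N) : Prop :=
  dollar ≠ S' ∧ G.start = S' ∧
  ∀ p : G.P,
    ((dollar ∉ G.lhs p ∧ S' ∉ G.lhs p) ∧
      ∃ β : List G.N, β ≠ [] ∧ dollar ∉ β ∧ S' ∉ β ∧ (G.lhs p).length ≤ β.length ∧
        G.rhs p = β.map Sum.inl) ∨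
    (G.lhs p = [S'] ∧ ∃ α : List G.N, α ≠ [] ∧ dollar ∉ α ∧ S' ∉ α ∧
      G.rhs p = Sum.inl dollar :: α.map Sum.inl) ∨
    (∃ A : G.N, A ≠ dollar ∧ A ≠ S' ∧ G.lhs p = [dollar, A] ∧
      ∃ a : T, G.rhs p = [Sum.inr a, Sum.inl dollar])

end OmegaPSG

/-- `𝓛_{σ,ρ,π}(X)` for the family `X` of ω-grammars over `T` satisfying `C`. -/
def GLang (T : Type) (C : OmegaPSG T → Prop) (σ : AccSigma) (ρ : AccRho) (π : DerivMode) :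
    Set (Set (ℕ → T)) :=
  {L | ∃ G : OmegaPSG T, C G ∧ L = G.Lang σ ρ π}

/-- number of non-ε labels among `b 0, …, b (i-1)`. -/
def someCount {A : Type _} (b : ℕ → Option A) (i : ℕ) : ℕ :=
  ((Finset.range i).filter fun j => (b j).isSome = true).card

/-- the (ε-allowing) label sequence `b` concatenates to the ω-word `u`. -/
def Spells {A : Type _} (b : ℕ → Option A) (u : ℕ → A) : Prop :=
  (∀ n : ℕ, ∃ i : ℕ, n ≤ someCount b i) ∧
  ∀ i : ℕ, ∀ a : A, b i = some a → a = u (someCount b i)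

/-- A finite state ω-automaton `(Q, Σ, δ, q₀, 𝓕)`. -/
structure OmegaFSA (Sig : Type) where
  Q : Type
  [fintypeQ : Fintype Q]
  init : Q
  trans : Q → Option Sig → Q → Prop
  acc : Set (Set Q)

/-- `L_{σ,ρ}(A)` for a finite state ω-automaton. -/
def OmegaFSA.Lang {Sig : Type} (A : OmegaFSA Sig) (σ : AccSigma) (ρ : AccRho) :
    Set (ℕ → Sig) :=
  {u | ∃ (r : ℕ → A.Q) (b : ℕ → Option Sig),
    r 0 = A.init ∧ (∀ i : ℕ, A.trans (r i) (b i) (r (i + 1))) ∧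
    Spells b u ∧ IsAccepting σ ρ A.acc r}

/-- `𝓛_{σ,ρ}(ω-FSA)`. -/
def FSALang (Sig : Type) (σ : AccSigma) (ρ : AccRho) : Set (Set (ℕ → Sig)) :=
  {L | ∃ A : OmegaFSA Sig, L = A.Lang σ ρ}

/-- A pushdown ω-automaton `(Q, Σ, Γ, δ, q₀, Z₀, 𝓕)`. -/
structure OmegaPDA (Sig : Type) where
  Q : Type
  [fintypeQ : Fintype Q]
  Γ : Type
  [fintypeΓ : Fintype Γ]
  init : Q
  Z0 : Γ
  trans : Q → Option Sig → Γ → Q → List Γ → Prop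
  acc : Set (Set Q)

/-- `L_{σ,ρ}(D)` for a pushdown ω-automaton. -/
def OmegaPDA.Lang {Sig : Type} (D : OmegaPDA Sig) (σ : AccSigma) (ρ : AccRho) :
    Set (ℕ → Sig) :=
  {u | ∃ (q : ℕ → D.Q) (st : ℕ → List D.Γ) (b : ℕ → Option Sig),
    q 0 = D.init ∧ st 0 = [D.Z0] ∧
    (∀ i : ℕ, ∃ (Z : D.Γ) (γ rest : List D.Γ),
      st i = Z :: rest ∧ D.trans (q i) (b i) Z (q (i + 1)) γ ∧ st (i + 1) = γ ++ rest) ∧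
    Spells b u ∧ IsAccepting σ ρ D.acc q}

/-- `𝓛_{σ,ρ}(ω-PDA)`. -/
def PDALang (Sig : Type) (σ : AccSigma) (ρ : AccRho) : Set (Set (ℕ → Sig)) :=
  {L | ∃ D : OmegaPDA Sig, L = D.Lang σ ρ}

/-- tape head moves. -/
inductive Move | L | R | S
deriving DecidableEq

def moveHead : Move → ℕ → ℕ
  | .L, n => n - 1
  | .R, n => n + 1
  | .S, n => n

/-- A single-tape Turing ω-machine `(Q, Σ, Γ, δ, q₀, 𝓕)` (Σ ⊆ Γ via `embed`). -/
structure OmegaTM (Sig : Type) where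
  Q : Type
  [fintypeQ : Fintype Q]
  Γ : Type
  [fintypeΓ : Fintype Γ]
  embed : Sig → Γ
  embed_inj : Function.Injective embed
  init : Q
  trans : Q → Γ → Q → Γ → Move → Prop
  acc : Set (Set Q)

/-- `L_{σ,ρ}(M)`: ω-words admitting a complete non-oscillating run whose state
sequence is (σ,ρ)-accepting. -/
def OmegaTM.Lang {Sig : Type} (M : OmegaTM Sig) (σ : AccSigma) (ρ : AccRho) :
    Set (ℕ → Sig) :=
  {u | ∃ (q : ℕ → M.Q) (tape : ℕ → ℕ → M.Γ) (pos : ℕ → ℕ),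
    q 0 = M.init ∧ (∀ n : ℕ, tape 0 n = M.embed (u n)) ∧ pos 0 = 0 ∧
    (∀ i : ℕ, ∃ (g : M.Γ) (m : Move),
      M.trans (q i) (tape i (pos i)) (q (i + 1)) g m ∧
      tape (i + 1) = Function.update (tape i) (pos i) g ∧
      pos (i + 1) = moveHead m (pos i)) ∧
    (∀ n : ℕ, ∃ i : ℕ, n ≤ pos i) ∧
    (∀ n : ℕ, ∃ i0 : ℕ, ∀ i : ℕ, i0 ≤ i → pos i ≠ n) ∧
    IsAccepting σ ρ M.acc q}

/-- `𝓛_{σ,ρ}(ω-TM)`. -/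
def TMLang (Sig : Type) (σ : AccSigma) (ρ : AccRho) : Set (Set (ℕ → Sig)) :=
  {L | ∃ M : OmegaTM Sig, L = M.Lang σ ρ}

/-- An m-tape Turing ω-machine. -/
structure OmegaMTM (m : ℕ) (Sig : Type) where
  Q : Type
  [fintypeQ : Fintype Q]
  Γ : Type
  [fintypeΓ : Fintype Γ]
  embed : Sig → Γ
  embed_inj : Function.Injective embed
  blank : Γ
  init : Q
  trans : Q → (Fin m → Γ) → Q → (Fin m → Γ) → (Fin m → Move) → Prop
  acc : Set (Set Q)

/-- `L_{σ,ρ}(M)` for an m-tape Turing ω-machine (`hm : 0 < m`; the input is on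
the first tape, the other tapes are initially blank; the run must be complete
and non-oscillating on the first tape). -/
def OmegaMTM.Lang {m : ℕ} {Sig : Type} (M : OmegaMTM m Sig) (hm : 0 < m)
    (σ : AccSigma) (ρ : AccRho) : Set (ℕ → Sig) :=
  {u | ∃ (q : ℕ → M.Q) (tape : ℕ → Fin m → ℕ → M.Γ) (pos : ℕ → Fin m → ℕ),
    q 0 = M.init ∧
    (∀ n : ℕ, tape 0 ⟨0, hm⟩ n = M.embed (u n)) ∧
    (∀ j : Fin m, j ≠ ⟨0, hm⟩ → ∀ n : ℕ, tape 0 j n = M.blank) ∧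
    (∀ j : Fin m, pos 0 j = 0) ∧
    (∀ i : ℕ, ∃ (g : Fin m → M.Γ) (mv : Fin m → Move),
      M.trans (q i) (fun j => tape i j (pos i j)) (q (i + 1)) g mv ∧
      (∀ j : Fin m, tape (i + 1) j = Function.update (tape i j) (pos i j) (g j)) ∧
      (∀ j : Fin m, pos (i + 1) j = moveHead (mv j) (pos i j))) ∧
    (∀ n : ℕ, ∃ i : ℕ, n ≤ pos i ⟨0, hm⟩) ∧
    (∀ n : ℕ, ∃ i0 : ℕ, ∀ i : ℕ, i0 ≤ i → pos i ⟨0, hm⟩ ≠ n) ∧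
    IsAccepting σ ρ M.acc q}

/-- `𝓛_{σ,ρ}(m-ω-TM)`. -/
def MTMLang (Sig : Type) (m : ℕ) (hm : 0 < m) (σ : AccSigma) (ρ : AccRho) :
    Set (Set (ℕ → Sig)) :=
  {L | ∃ M : OmegaMTM m Sig, L = M.Lang hm σ ρ}

/-- the ω-language `{aⁿbⁿ | n ≥ 1}^ω` over the alphabet `Bool`
(`false` = a, `true` = b). -/
def abLang : Set (ℕ → Bool) :=
  {u | ∃ n : ℕ → ℕ, (∀ i : ℕ, 1 ≤ n i) ∧
    ∀ i k : ℕ, k < 2 * n i →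
      u ((∑ j ∈ Finset.range i, 2 * n j) + k) = decide (n i ≤ k)}

end OmegaFormal

namespace OmegaFormal
namespace OmegaPSG

variable {T : Type} (G : OmegaPSG T)

/-- In leftmost mode the part of a sentential form to the left of a rewritten symbol is terminal. -/
def LeftContext {N : Type} (π : DerivMode) (x : List (N ⊕ T)) : Prop :=
  π = .l → ∀ s ∈ x, ∃ a : T, s = Sum.inr a

variable {G}

theorem stepOf_iff {π : DerivMode} {p : G.P} {x y : List (G.N ⊕ T)} :
    G.StepOf π p x y ↔ ∃ u v, LeftContext π u ∧
      x = u ++ (G.lhs p).map Sum.inl ++ v ∧ y = u ++ G.rhs p ++ v := by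
  cases π <;> simp [StepOf, Step, LStep, LeftContext]

variable (G)

/-- A finite derivation with its sequence of productions. -/
inductive Run (π : DerivMode) : List (G.N ⊕ T) → List G.P → List (G.N ⊕ T) → Prop
  | nil (x) : Run π x [] x
  | cons {p x y z l} : G.StepOf π p x y → Run π y l z → Run π x (p :: l) z

/-- `Erases l M`: the word `l` of nonterminals derives the empty word, using the multiset `M`
of productions. -/
inductive Erases : List (G.N ⊕ T) → Multiset G.P → Prop
  | nil : Erases [] 0
  | cons {p A l M M'} : G.lhs p = [A] → Erases (G.rhs p) M → Erases l M' →
      Erases (Sum.inl A :: l) (p ::ₘ (M + M'))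

/-- Nonterminals of the ε-free grammar. The symbol `some (A, R, b)` stands for `A` together with
erasable symbols that follow it, up to the next nonterminal, whose erasure uses exactly the
productions in `R`; the Boolean is the parity of the depth in the derivation tree.
The symbol `none` has no productions and stands for the empty word. -/
abbrev LazyN : Type := Option (G.N × Set G.P × Bool)

/-- `Lazy R O x y`: the sentential form `x` over `LazyN` represents `y`, where `O` collects the
productions erasing the symbols of `y` that precede the first nonterminal of `x`, and `R` those
promised to be erased to the right of `y`. -/
inductive Lazy (R : Set G.P) : Set G.P → List (G.LazyN ⊕ T) → List (G.N ⊕ T) → Prop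
  | nil : Lazy R R [] []
  | term {O x y} (a : T) : Lazy R O x y → Lazy R O (Sum.inr a :: x) (Sum.inr a :: y)
  | erased {O x y A M} : G.Erases [Sum.inl A] M → Lazy R O x y →
      Lazy R ({q | q ∈ M} ∪ O) x (Sum.inl A :: y)
  | kept {O x y} (A : G.N) (b : Bool) : Lazy R O x y →
      Lazy R ∅ (Sum.inl (some (A, O, b)) :: x) (Sum.inl A :: y)
  | dead {O x y} : Lazy R O x y → Lazy R O (Sum.inl none :: x) y

variable {G}

theorem Run.append {π : DerivMode} {x y z : List (G.N ⊕ T)} {l l' : List G.P}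
    (h : G.Run π x l y) (h' : G.Run π y l' z) : G.Run π x (l ++ l') z := by
  induction h with
  | nil => exact h'
  | cons hs _ ih => exact .cons hs (ih h')

theorem LeftContext.append_term {N : Type} {π : DerivMode} {x : List (N ⊕ T)}
    (h : LeftContext π x) (a : T) : LeftContext π (x ++ [Sum.inr a]) := by
  intro hπ s hs
  simp only [List.mem_append, List.mem_singleton] at hs
  rcases hs with hs | rfl
  · exact h hπ s hs
  · exact ⟨a, rfl⟩

theorem Erases.exists_run {l : List (G.N ⊕ T)} {M : Multiset G.P} (h : G.Erases l M)
    {π : DerivMode} {x : List (G.N ⊕ T)} (hx : LeftContext π x) (y : List (G.N ⊕ T)) :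
    ∃ L, (∀ q, q ∈ L ↔ q ∈ M) ∧ G.Run π (x ++ l ++ y) L (x ++ y) := by
  induction h generalizing y with
  | nil => exact ⟨[], by simp, by simpa using Run.nil _⟩
  | @cons p A l M M' hp _ _ ih ih' =>
    obtain ⟨L, hL, hr⟩ := ih (l ++ y)
    obtain ⟨L', hL', hr'⟩ := ih' y
    refine ⟨p :: (L ++ L'), by simp [hL, hL'], .cons (y := x ++ G.rhs p ++ (l ++ y)) ?_ ?_⟩
    · exact stepOf_iff.2 ⟨x, l ++ y, hx, by simp [hp], rfl⟩
    · exact hr.append (by simpa using hr')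

theorem Erases.nonempty_of_singleton {A : G.N} {M : Multiset G.P}
    (h : G.Erases [Sum.inl A] M) : ∃ q, q ∈ M := by
  cases h with
  | @cons p => exact ⟨p, Multiset.mem_cons_self _ _⟩

theorem Lazy.append {R O O' : Set G.P} {x x' : List (G.LazyN ⊕ T)} {y y' : List (G.N ⊕ T)}
    (h : G.Lazy O O' x y) (h' : G.Lazy R O x' y') : G.Lazy R O' (x ++ x') (y ++ y') := by
  induction h with
  | nil => exact h'
  | term a _ ih => exact .term a ih
  | erased he _ ih => exact .erased he ih
  | kept A b _ ih => exact .kept A b ih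
  | dead _ ih => exact .dead ih

theorem Lazy.split {R O S : Set G.P} {z : List (G.LazyN ⊕ T)} {y : List (G.N ⊕ T)}
    (h : G.Lazy R O z y) {x x' : List (G.LazyN ⊕ T)} {A : G.N} {b : Bool}
    (hz : z = x ++ Sum.inl (some (A, S, b)) :: x') :
    ∃ u v, y = u ++ Sum.inl A :: v ∧ G.Lazy ∅ O x u ∧ G.Lazy R S x' v := by
  induction h generalizing x with
  | nil => simp at hz
  | @term O z y a _ ih =>
    cases x with
    | nil => simp at hz
    | cons c x =>
      simp only [List.cons_append, List.cons.injEq] at hz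
      obtain ⟨u, v, rfl, h1, h2⟩ := ih hz.2
      exact ⟨Sum.inr a :: u, v, rfl, hz.1 ▸ .term a h1, h2⟩
  | @erased O z y B M he _ ih =>
    obtain ⟨u, v, rfl, h1, h2⟩ := ih hz
    exact ⟨Sum.inl B :: u, v, rfl, .erased he h1, h2⟩
  | @kept O z y B c hl ih =>
    cases x with
    | nil =>
      simp only [List.nil_append, List.cons.injEq, Sum.inl.injEq, Option.some.injEq,
        Prod.mk.injEq] at hz
      obtain ⟨⟨rfl, rfl, rfl⟩, rfl⟩ := hz
      exact ⟨[], y, rfl, .nil, hl⟩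
    | cons c' x =>
      simp only [List.cons_append, List.cons.injEq] at hz
      obtain ⟨u, v, rfl, h1, h2⟩ := ih hz.2
      exact ⟨Sum.inl B :: u, v, rfl, hz.1 ▸ .kept B c h1, h2⟩
  | @dead O z y _ ih =>
    cases x with
    | nil => simp at hz
    | cons c' x =>
      simp only [List.cons_append, List.cons.injEq] at hz
      obtain ⟨u, v, rfl, h1, h2⟩ := ih hz.2
      exact ⟨u, v, rfl, hz.1 ▸ .dead h1, h2⟩

theorem Erases.union_ne_empty {A : G.N} {M : Multiset G.P} (h : G.Erases [Sum.inl A] M)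
    (O : Set G.P) : {q | q ∈ M} ∪ O ≠ ∅ := by
  obtain ⟨q, hq⟩ := h.nonempty_of_singleton
  exact Set.nonempty_iff_ne_empty.1 ⟨q, .inl hq⟩

theorem Lazy.leftContext {π : DerivMode} {R O : Set G.P} {x : List (G.LazyN ⊕ T)}
    {y : List (G.N ⊕ T)} (h : G.Lazy R O x y) (hO : O = ∅) (hx : LeftContext π x) :
    LeftContext π y := by
  intro hπ
  replace hx := hx hπ
  induction h with
  | nil => simp
  | @term O x y a _ ih =>
    have := ih hO fun s hs => hx s (List.mem_cons_of_mem _ hs)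
    simpa using this
  | erased he _ _ => exact absurd hO (he.union_ne_empty _)
  | kept A b _ _ => simpa using hx (Sum.inl _) List.mem_cons_self
  | dead _ _ => simpa using hx (Sum.inl _) List.mem_cons_self

theorem Lazy.termPrefix_mono {R O : Set G.P} {x : List (G.LazyN ⊕ T)}
    {y : List (G.N ⊕ T)} (h : G.Lazy R O x y) (hO : O = ∅) : termPrefix x <+: termPrefix y := by
  induction h with
  | nil => simp [termPrefix]
  | term a _ ih => simpa [termPrefix] using ih hO
  | erased he _ _ => exact absurd hO (he.union_ne_empty _)
  | kept A b _ _ => simp [termPrefix]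
  | dead _ _ => simp [termPrefix]

/-- The symbols preceding the first nonterminal can be erased at once. -/
theorem Lazy.exists_flush {O : Set G.P} {x : List (G.LazyN ⊕ T)} {y : List (G.N ⊕ T)}
    (h : G.Lazy ∅ O x y) {π : DerivMode} {u : List (G.N ⊕ T)} (hu : LeftContext π u) :
    ∃ L y', {q | q ∈ L} = O ∧ G.Run π (u ++ y) L (u ++ y') ∧ G.Lazy ∅ ∅ x y' := by
  induction h generalizing u with
  | nil => exact ⟨[], [], by simp, .nil _, .nil⟩
  | @term O x y a _ ih =>
    obtain ⟨L, y', hL, hr, hl⟩ := ih (hu.append_term a)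
    exact ⟨L, _, hL, by simpa using hr, .term a hl⟩
  | @erased O x y A M he _ ih =>
    obtain ⟨L, y', hL, hr, hl⟩ := ih hu
    obtain ⟨L', hL', hr'⟩ := he.exists_run hu y
    refine ⟨L' ++ L, y', ?_, ?_, hl⟩
    · rw [← hL]; ext q; simp [hL']
    · exact Run.append (by simpa using hr') hr
  | @kept O x y A b hl _ => exact ⟨[], _, by simp, .nil _, .kept A b hl⟩
  | dead _ ih =>
    obtain ⟨L, y', hL, hr, hl⟩ := ih hu
    exact ⟨L, y', hL, hr, .dead hl⟩

variable (G)

/-- The nonterminal rewritten by a context-free production. -/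
def lhsHead (p : G.P) : G.N := (G.lhs p).head (G.lhs_ne p)

/-- Names of the productions of the ε-free grammar. -/
structure LazyProd where
  /-- the simulated production -/
  prod : G.P
  /-- the productions promised at the rewritten symbol -/
  promised : Set G.P
  /-- the parity of the rewritten symbol -/
  parity : Bool
  /-- the productions of the erasures carried out along with this step -/
  erasing : Set G.P
  /-- the new right-hand side -/
  body : List (G.LazyN ⊕ T)
  lazy : G.Lazy promised erasing body (G.rhs prod)
  body_ne : body ≠ []
  length_le : body.length ≤ (G.rhs prod).length + 1
  parity_ne : ∀ A R b, Sum.inl (some (A, R, b)) ∈ body → b ≠ parity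

/-- The productions of the original grammar that are used in the simulation of a step. -/
def LazyProd.used {G : OmegaPSG T} (c : G.LazyProd) : Set G.P := insert c.prod c.erasing

theorem finite_lazyProd [Finite T] : Finite G.LazyProd := by
  have := G.fintypeN
  have := G.fintypeP
  obtain ⟨K, hK⟩ := (Set.finite_range fun p => (G.rhs p).length).bddAbove
  have : Finite {l : List (G.LazyN ⊕ T) // l.length ≤ K + 1} :=
    (List.finite_length_le (G.LazyN ⊕ T) (K + 1)).to_subtype
  let f : G.LazyProd → G.P × Set G.P × Bool × Set G.P ×
      {l : List (G.LazyN ⊕ T) // l.length ≤ K + 1} := fun c =>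
    (c.prod, c.promised, c.parity, c.erasing,
      ⟨c.body, c.length_le.trans (Nat.succ_le_succ (hK ⟨c.prod, rfl⟩))⟩)
  refine Finite.of_injective f fun c c' h => ?_
  cases c
  cases c'
  simpa [f] using h

/-- The ε-free grammar. -/
noncomputable def lazyGrammar [Finite T] : OmegaPSG T where
  N := G.LazyN
  fintypeN := by
    have := G.fintypeN
    have := G.fintypeP
    exact Fintype.ofFinite _
  P := G.LazyProd
  fintypeP := by
    have := G.finite_lazyProd
    exact Fintype.ofFinite _
  lhs c := [some (G.lhsHead c.prod, c.promised, c.parity)]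
  lhs_ne _ := List.cons_ne_nil _ _
  rhs c := c.body
  start := some (G.start, ∅, false)
  acc := {H | (⋃ c ∈ H, c.used) ∈ G.acc} ∪
    {H | ∃ c : G.LazyProd, (c.used ∩ ⋃₀ G.acc).Nonempty ∧ H = {c}}

variable {G}

theorem lhs_eq_of_isCFG (hG : G.IsCFG) (p : G.P) : G.lhs p = [G.lhsHead p] := by
  obtain ⟨A, hA⟩ := List.length_eq_one_iff.1 (hG p)
  simp [lhsHead, hA]

/-- A step of the ε-free grammar is simulated by a finite derivation. -/
theorem exists_run_of_lazyGrammar_step [Finite T] (hG : G.IsCFG) {π : DerivMode}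
    {c : G.LazyProd} {x x' : List (G.LazyN ⊕ T)} {y : List (G.N ⊕ T)}
    (hs : G.lazyGrammar.StepOf π c x x') (h : G.Lazy ∅ ∅ x y) :
    ∃ L y', L ≠ [] ∧ {q | q ∈ L} = c.used ∧ G.Run π y L y' ∧ G.Lazy ∅ ∅ x' y' := by
  obtain ⟨u, v, hu, hx, hx'⟩ := stepOf_iff.1 hs
  obtain ⟨u', v', rfl, hu', hv'⟩ := h.split (x := u) (x' := v)
    (A := G.lhsHead c.prod) (S := c.promised) (b := c.parity)
    (by rw [hx]; exact List.append_assoc _ _ _)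
  have hctx : LeftContext π u' := hu'.leftContext rfl hu
  obtain ⟨L, y', hL, hr, hl⟩ := (c.lazy.append hv').exists_flush hctx
  refine ⟨c.prod :: L, u' ++ y', by simp, ?_, .cons (y := u' ++ (G.rhs c.prod ++ v')) ?_ hr, ?_⟩
  · rw [LazyProd.used, ← hL]; ext; simp
  · exact stepOf_iff.2 ⟨u', v', hctx, by simp [lhs_eq_of_isCFG hG], by simp⟩
  · rw [hx', List.append_assoc]
    exact hu'.append hl

theorem termPrefix_prefix_append {N : Type} (u : List (N ⊕ T)) (A : N) (v w : List (N ⊕ T)) :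
    termPrefix (u ++ Sum.inl A :: v) <+: termPrefix (u ++ w) := by
  induction u with
  | nil => simp [termPrefix]
  | cons c u ih => cases c <;> simp [termPrefix, ih]

theorem termPrefix_prefix_of_stepOf {π : DerivMode} {p : G.P} {x y : List (G.N ⊕ T)}
    (h : G.StepOf π p x y) : termPrefix x <+: termPrefix y := by
  obtain ⟨u, v, -, rfl, rfl⟩ := stepOf_iff.1 h
  obtain ⟨A, l, hA⟩ := List.exists_cons_of_ne_nil (G.lhs_ne p)
  simpa [hA] using termPrefix_prefix_append u A (l.map Sum.inl ++ v) (G.rhs p ++ v)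

end OmegaPSG
end OmegaFormal

namespace OmegaFormal

/-- Dependent choice along the natural numbers, with invariant `I` and labelled transitions `R`. -/
theorem exists_seq {α β : Type*} {I : ℕ → α → Prop} {R : ℕ → α → β → α → Prop} {a : α}
    (ha : I 0 a) (h : ∀ i a, I i a → ∃ b a', I (i + 1) a' ∧ R i a b a') :
    ∃ (s : ℕ → α) (d : ℕ → β), s 0 = a ∧ ∀ i, I i (s i) ∧ R i (s i) (d i) (s (i + 1)) := by
  choose b n hI hR using h
  let s : (i : ℕ) → {a // I i a} := fun i =>
    Nat.rec ⟨a, ha⟩ (fun i x => ⟨n i x.1 x.2, hI i x.1 x.2⟩) i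
  exact ⟨fun i => (s i).1, fun i => b i (s i).1 (s i).2, rfl,
    fun i => ⟨(s i).2, hR i (s i).1 (s i).2⟩⟩

/-- The elements of at least one (`ran`), respectively infinitely many (`inf`), of the sets. -/
def limSet {Q : Type*} : AccSigma → (ℕ → Set Q) → Set Q
  | .ran, C => {q | ∃ m, q ∈ C m}
  | .inf, C => {q | ∀ n, ∃ m, n ≤ m ∧ q ∈ C m}

theorem limSet_eq_biUnion {Q Q' : Type*} [Finite Q'] (σ : AccSigma) (f : ℕ → Q')
    (C : Q' → Set Q) : limSet σ (fun i => C (f i)) = ⋃ c ∈ sigmaSet σ f, C c := by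
  cases σ with
  | ran => ext q; simp [limSet, sigmaSet]
  | inf =>
    ext q
    simp only [limSet, sigmaSet, Set.mem_ofPred_eq, Set.mem_iUnion, exists_prop]
    constructor
    · intro h
      by_contra! hc
      have : ∀ c : Q', ∃ n, ∀ m, n ≤ m → f m = c → q ∉ C c := by
        intro c
        by_cases hq : q ∈ C c
        · by_contra! h'
          refine hc c (fun n => ?_) hq
          obtain ⟨m, hm, hf, -⟩ := h' n
          exact ⟨m, hm, hf⟩
        · exact ⟨0, fun _ _ _ => hq⟩
      choose n hn using this
      obtain ⟨K, hK⟩ := (Set.finite_range n).bddAbove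
      obtain ⟨m, hm, hq⟩ := h K
      exact hn (f m) m ((hK ⟨_, rfl⟩).trans hm) rfl hq
    · rintro ⟨c, hc, hq⟩ n
      obtain ⟨m, hm, rfl⟩ := hc n
      exact ⟨m, hm, hq⟩

/-- The set of letters occurring at least once or infinitely often does not change when each
letter set is expanded into a block of letters. -/
theorem sigmaSet_eq_limSet {Q : Type*} {d : ℕ → Q} {C : ℕ → Set Q} {φ : ℕ → ℕ}
    (hle : ∀ i, φ i ≤ i) (htop : ∀ n, ∃ i₀, ∀ i, i₀ ≤ i → n ≤ φ i)
    (hmem : ∀ i, d i ∈ C (φ i)) (hex : ∀ k, ∀ q ∈ C k, ∃ i, φ i = k ∧ d i = q)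
    (σ : AccSigma) : sigmaSet σ d = limSet σ C := by
  ext q
  cases σ with
  | ran =>
    constructor
    · rintro ⟨i, rfl⟩
      exact ⟨_, hmem i⟩
    · rintro ⟨k, hk⟩
      obtain ⟨i, -, hi⟩ := hex k q hk
      exact ⟨i, hi⟩
  | inf =>
    constructor
    · intro h n
      obtain ⟨i₀, hi₀⟩ := htop n
      obtain ⟨m, hm, rfl⟩ := h i₀
      exact ⟨φ m, hi₀ m hm, hmem m⟩
    · intro h n
      obtain ⟨k, hk, hq⟩ := h n
      obtain ⟨i, rfl, hi⟩ := hex k q hq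
      exact ⟨i, hk.trans (hle i), hi⟩

theorem MatchesPrefix.of_isPrefix {T : Type*} {l l' : List T} {u : ℕ → T}
    (h : MatchesPrefix l u) (hl : l' <+: l) : MatchesPrefix l' u := by
  intro k hk
  rw [← h k (hk.trans_le hl.length_le)]
  exact hl.getElem hk

/-- If a sequence of words spells `u` and is dominated by another increasing sequence of
words, then this one spells `u` as well. -/
theorem spells_of_dominated {T : Type*} {f g : ℕ → List T} {u : ℕ → T}
    (hg : ∀ i, g i <+: g (i + 1))
    (hfg : ∀ i, ∃ j, f i <+: g j) (hgrow : ∀ n, ∃ i, n ≤ (f i).length)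
    (hu : ∀ i, MatchesPrefix (f i) u) :
    (∀ n, ∃ i, n ≤ (g i).length) ∧ ∀ i, MatchesPrefix (g i) u := by
  have hg' : ∀ i j, i ≤ j → g i <+: g j := fun i j h => by
    induction h with
    | refl => exact List.prefix_rfl
    | step _ ih => exact ih.trans (hg _)
  constructor
  · intro n
    obtain ⟨i, hi⟩ := hgrow n
    obtain ⟨j, hj⟩ := hfg i
    exact ⟨j, hi.trans hj.length_le⟩
  · intro k
    obtain ⟨i, hi⟩ := hgrow (g k).length
    obtain ⟨j, hj⟩ := hfg i
    refine (hu i).of_isPrefix (List.prefix_of_prefix_length_le (l₃ := g (max k j)) ?_ ?_ hi)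
    · exact hg' _ _ (le_max_left _ _)
    · exact hj.trans (hg' _ _ (le_max_right _ _))

namespace OmegaPSG

variable {T : Type} {G : OmegaPSG T}

/-- An infinite sequence of nonempty finite derivations concatenates to an infinite one. -/
theorem exists_concat_runs {π : DerivMode} {x : ℕ → List (G.N ⊕ T)} {L : ℕ → List G.P}
    (hL : ∀ k, L k ≠ []) (hr : ∀ k, G.Run π (x k) (L k) (x (k + 1))) :
    ∃ (s : ℕ → List (G.N ⊕ T)) (d : ℕ → G.P), s 0 = x 0 ∧
      (∀ i, G.StepOf π (d i) (s i) (s (i + 1))) ∧ (∀ k, ∃ i, s i = x k) ∧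
      ∀ σ, sigmaSet σ d = limSet σ fun k => {q | q ∈ L k} := by
  obtain ⟨S, d, h0, hS⟩ := exists_seq (α := ℕ × List (G.N ⊕ T) × List G.P) (β := G.P)
    (I := fun _ a => a.2.2 ≠ [] ∧ a.2.2 ⊆ L a.1 ∧ G.Run π a.2.1 a.2.2 (x (a.1 + 1)))
    (R := fun _ a p b => G.StepOf π p a.2.1 b.2.1 ∧ ∃ l, a.2.2 = p :: l ∧
      ((l ≠ [] ∧ b.1 = a.1 ∧ b.2.2 = l) ∨ (l = [] ∧ b = (a.1 + 1, x (a.1 + 1), L (a.1 + 1)))))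
    (a := (0, x 0, L 0)) ⟨hL 0, fun _ h => h, hr 0⟩ (by
      rintro - ⟨k, y, l⟩ ⟨hne, hsub, hrun⟩
      dsimp only at hne hsub hrun
      generalize hz : x (k + 1) = z at hrun
      cases hrun with
      | nil => exact absurd rfl hne
      | @cons p _ y' _ l hs hrun =>
        by_cases hl : l = []
        · subst hl
          cases hrun
          subst hz
          exact ⟨p, _, ⟨hL (k + 1), fun _ h => h, hr (k + 1)⟩, hs, [], rfl, .inr ⟨rfl, rfl⟩⟩
        · exact ⟨p, (k, y', l), ⟨hl, fun _ h => hsub (List.mem_cons_of_mem _ h), hz ▸ hrun⟩, hs,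
            l, rfl, .inl ⟨hl, rfl, rfl⟩⟩)
  have hblock : ∀ l i, (S i).2.2 = l →
      (∀ q ∈ l, ∃ j, (S j).1 = (S i).1 ∧ d j = q) ∧
        ∃ j, S j = ((S i).1 + 1, x ((S i).1 + 1), L ((S i).1 + 1)) := by
    intro l
    induction l with
    | nil => intro i h; exact absurd h (hS i).1.1
    | cons p l ih =>
      intro i h
      obtain ⟨-, l', hl', hc⟩ := (hS i).2
      rw [h, List.cons.injEq] at hl'
      obtain ⟨hp, rfl⟩ := hl'
      rcases hc with ⟨-, hk, hl⟩ | ⟨rfl, hb⟩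
      · obtain ⟨h1, h2⟩ := ih (i + 1) hl
        rw [hk] at h1 h2
        refine ⟨fun q hq => ?_, h2⟩
        rcases List.mem_cons.1 hq with rfl | hq
        · exact ⟨i, rfl, hp.symm⟩
        · exact h1 q hq
      · refine ⟨fun q hq => ⟨i, rfl, ?_⟩, i + 1, hb⟩
        rw [← hp, List.mem_singleton.1 hq]
  have hreach : ∀ k, ∃ i, S i = (k, x k, L k) := by
    intro k
    induction k with
    | zero => exact ⟨0, h0⟩
    | succ k ih =>
      obtain ⟨i, hi⟩ := ih
      simpa [hi] using (hblock _ i rfl).2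
  have hstep : ∀ i, (S (i + 1)).1 = (S i).1 ∨ (S (i + 1)).1 = (S i).1 + 1 := by
    intro i
    obtain ⟨-, l, -, ⟨-, h, -⟩ | ⟨-, h⟩⟩ := (hS i).2
    · exact .inl h
    · exact .inr (by rw [h])
  have hmono : Monotone fun i => (S i).1 := monotone_nat_of_le_succ fun i => by
    rcases hstep i with h | h <;> omega
  refine ⟨fun i => (S i).2.1, d, by simp [h0], fun i => (hS i).2.1, fun k => ?_, fun σ => ?_⟩
  · obtain ⟨i, hi⟩ := hreach k
    exact ⟨i, by simp [hi]⟩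
  · refine sigmaSet_eq_limSet (φ := fun i => (S i).1) (fun i => ?_) (fun n => ?_) (fun i => ?_)
      (fun k q hq => ?_) σ
    · induction i with
      | zero => simp [h0]
      | succ i ih => rcases hstep i with h | h <;> simp only [h] <;> omega
    · obtain ⟨i, hi⟩ := hreach n
      refine ⟨i, fun j hj => ?_⟩
      have := hmono hj
      simpa [hi] using this
    · obtain ⟨-, l, hl, -⟩ := (hS i).2
      exact (hS i).1.2.1 (by simp [hl])
    · obtain ⟨i, hi⟩ := hreach k
      have := (hblock _ i rfl).1 q (by simpa [hi] using hq)
      simpa [hi] using this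

/-- The sentential forms of `s` start with `G.start`, are rewritten along `d`, and spell `u`. -/
structure Generates (G : OmegaPSG T) (π : DerivMode) (u : ℕ → T) (s : ℕ → List (G.N ⊕ T))
    (d : ℕ → G.P) : Prop where
  zero : s 0 = [Sum.inl G.start]
  step : ∀ i, G.StepOf π (d i) (s i) (s (i + 1))
  grow : ∀ n, ∃ i, n ≤ (termPrefix (s i)).length
  spell : ∀ i, MatchesPrefix (termPrefix (s i)) u

theorem exists_generates_of_lazyGrammar [Finite T] (hG : G.IsCFG) {π : DerivMode} {u : ℕ → T}
    {s' : ℕ → List (G.LazyN ⊕ T)} {d' : ℕ → G.LazyProd}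
    (h : G.lazyGrammar.Generates π u s' d') :
    ∃ s d, G.Generates π u s d ∧ ∀ σ, sigmaSet σ d = limSet σ fun k => (d' k).used := by
  obtain ⟨x, L, hx0, hx⟩ := exists_seq (α := List (G.N ⊕ T)) (β := List G.P)
    (I := fun k y => G.Lazy ∅ ∅ (s' k) y)
    (R := fun k y l y' => l ≠ [] ∧ {q | q ∈ l} = (d' k).used ∧ G.Run π y l y')
    (a := [Sum.inl G.start]) (by rw [h.zero]; exact .kept _ _ .nil) (by
      intro k y hy
      obtain ⟨l, y', h1, h2, h3, h4⟩ := exists_run_of_lazyGrammar_step hG (h.step k) hy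
      exact ⟨l, y', h4, h1, h2, h3⟩)
  obtain ⟨s, d, hs0, hs, hhit, hσ⟩ :=
    exists_concat_runs (fun k => (hx k).2.1) (fun k => (hx k).2.2.2)
  have hspell := spells_of_dominated (f := fun k => termPrefix (s' k))
    (g := fun i => termPrefix (s i)) (u := u)
    (fun i => termPrefix_prefix_of_stepOf (hs i)) (fun k => by
      obtain ⟨i, hi⟩ := hhit k
      exact ⟨i, by rw [hi]; exact (hx k).1.termPrefix_mono rfl⟩) h.grow h.spell
  refine ⟨s, d, ⟨hs0.trans hx0, hs, hspell.1, hspell.2⟩, fun σ => ?_⟩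
  rw [hσ]
  congr 1
  exact funext fun k => (hx k).2.2.1

end OmegaPSG
end OmegaFormal

namespace OmegaFormal
namespace OmegaPSG

variable {T : Type} (G : OmegaPSG T)

/-- The fate of an occurrence of a symbol in an infinite derivation: it is erased completely by
the productions in a multiset, or it contributes to the generated ω-word (`lft`), or it lies
to the right of all that does, or its derivation tree is infinite (`rgt`). -/
inductive Fate
  | era (M : Multiset G.P)
  | lft
  | rgt

/-- A symbol with a fate. -/
abbrev Fated : Type := (G.N ⊕ T) × G.Fate

variable {G}

/-- The productions erasing a symbol. -/
def Fate.prods : G.Fate → Multiset G.P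
  | .era M => M
  | _ => 0

/-- The productions erasing the erased symbols of a word. -/
def owed (l : List G.Fated) : Multiset G.P := (l.map fun a => a.2.prods).sum

/-- Some symbol of the word has fate `rgt`. -/
def HasRgt (l : List G.Fated) : Prop := ∃ a ∈ l, a.2 = .rgt

open scoped Classical in
/-- The fate of a symbol rewritten with `p`, from the fates of the preceding symbols and of
those which replace it. -/
noncomputable def comb (p : G.P) (X Y : List G.Fated) : G.Fate :=
  if HasRgt X ∨ HasRgt Y then .rgt
  else if ∃ a ∈ Y, a.2 = .lft then .lft
  else .era (p ::ₘ owed Y)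

theorem comb_eq_rgt_iff {p : G.P} {X Y : List G.Fated} :
    comb p X Y = .rgt ↔ HasRgt X ∨ HasRgt Y := by
  unfold comb
  split_ifs <;> simp_all

theorem comb_eq_lft {p : G.P} {X Y : List G.Fated} (h : comb p X Y = .lft) :
    ¬ HasRgt X ∧ ¬ HasRgt Y ∧ ∃ a ∈ Y, a.2 = .lft := by
  unfold comb at h
  split_ifs at h
  simp_all

theorem comb_eq_era {p : G.P} {X Y : List G.Fated} {M : Multiset G.P}
    (h : comb p X Y = .era M) :
    ¬ HasRgt X ∧ M = p ::ₘ owed Y ∧ ∀ a ∈ Y, ∃ M', a.2 = .era M' := by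
  unfold comb at h
  split_ifs at h with h1 h2
  refine ⟨fun h => h1 (.inl h), (Fate.era.inj h).symm, fun a ha => ?_⟩
  cases hf : a.2 with
  | era M' => exact ⟨M', rfl⟩
  | lft => exact absurd ⟨a, ha, hf⟩ h2
  | rgt => exact absurd (.inr ⟨a, ha, hf⟩) h1

/-- The terminal prefix has fate `lft`, all the rest has fate `rgt`. -/
def mark : List (G.N ⊕ T) → List G.Fated
  | [] => []
  | Sum.inr a :: l => (Sum.inr a, .lft) :: mark l
  | Sum.inl A :: l => (Sum.inl A, .rgt) :: l.map fun c => (c, .rgt)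

/-- The fates before a step that rewrites the nonterminal `A` at position `m` with `p`, from those
after this step. -/
noncomputable def back (m : ℕ) (A : G.N) (p : G.P) (l : List G.Fated) : List G.Fated :=
  l.take m ++ (Sum.inl A, comb p (l.take m) ((l.drop m).take (G.rhs p).length)) ::
    l.drop (m + (G.rhs p).length)

/-- Fates may only change from `rgt` to another one. -/
def Refines (a b : G.Fated) : Prop := a.1 = b.1 ∧ (a.2 = .rgt ∨ a.2 = b.2)

theorem mark_map_fst (l : List (G.N ⊕ T)) : (mark l).map Prod.fst = l := by
  induction l with
  | nil => rfl
  | cons c l ih => cases c <;> simp [mark, ih, Function.comp_def]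

theorem refines_rgt_map (l : List (G.N ⊕ T)) (l' : List G.Fated) (h : l'.map Prod.fst = l) :
    List.Forall₂ Refines (l.map fun c => (c, (Fate.rgt : G.Fate))) l' := by
  subst h
  induction l' with
  | nil => exact .nil
  | cons a l ih => exact .cons ⟨rfl, .inl rfl⟩ ih

theorem back_map_fst {m : ℕ} {A : G.N} {p : G.P} {u v : List (G.N ⊕ T)} {l : List G.Fated}
    (hl : l.map Prod.fst = u ++ G.rhs p ++ v) (hm : u.length = m) :
    (back m A p l).map Prod.fst = u ++ Sum.inl A :: v := by
  subst hm
  simp [back, List.map_take, List.map_drop, hl]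

theorem refines_back_mark (u v : List (G.N ⊕ T)) (A : G.N) (p : G.P) :
    List.Forall₂ Refines (mark (u ++ Sum.inl A :: v))
      (back u.length A p (mark (u ++ G.rhs p ++ v))) := by
  have key : ∀ f : G.Fate, List.Forall₂ Refines (mark (u ++ Sum.inl A :: v))
      ((mark (u ++ G.rhs p ++ v)).take u.length ++ (Sum.inl A, f) ::
        (mark (u ++ G.rhs p ++ v)).drop (u.length + (G.rhs p).length)) := by
    intro f
    induction u with
    | nil =>
      refine refines_rgt_map (Sum.inl A :: v) _ ?_
      simp [List.map_drop, mark_map_fst]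
    | cons c u ih =>
      cases c with
      | inr a =>
        simp only [List.cons_append, mark, List.length_cons, List.take_succ_cons,
          Nat.add_right_comm _ 1, List.drop_succ_cons]
        exact .cons ⟨rfl, .inr rfl⟩ ih
      | inl B =>
        refine refines_rgt_map (Sum.inl B :: (u ++ Sum.inl A :: v)) _ ?_
        simp [List.map_take, List.map_drop, mark_map_fst, Nat.add_right_comm _ 1]
  exact key _

theorem Refines.eq_of_not_hasRgt {l l' : List G.Fated} (h : List.Forall₂ Refines l l')
    (hr : ¬ HasRgt l) : l = l' := by
  induction h with
  | nil => rfl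
  | @cons a b l l' hab _ ih =>
    have h1 : a = b := Prod.ext hab.1 (hab.2.resolve_left fun h =>
      hr ⟨a, List.mem_cons_self, h⟩)
    rw [h1, ih fun ⟨c, hc, hc'⟩ => hr ⟨c, List.mem_cons_of_mem _ hc, hc'⟩]

theorem back_refines {m : ℕ} {A : G.N} {p : G.P} {l l' : List G.Fated}
    (h : List.Forall₂ Refines l l') :
    List.Forall₂ Refines (back m A p l) (back m A p l') := by
  have h1 := List.forall₂_take m h
  have h2 := List.forall₂_take (G.rhs p).length (List.forall₂_drop m h)
  refine List.rel_append h1 (.cons ⟨rfl, ?_⟩ (List.forall₂_drop _ h))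
  by_cases hr : comb p (l.take m) ((l.drop m).take (G.rhs p).length) = .rgt
  · exact .inl hr
  · right
    rw [comb_eq_rgt_iff, not_or] at hr
    simp only
    rw [Refines.eq_of_not_hasRgt h1 hr.1, Refines.eq_of_not_hasRgt h2 hr.2]

open scoped Classical in
/-- The number of symbols with fate `rgt`. -/
noncomputable def rgtCount (l : List G.Fated) : ℕ := l.countP fun a => decide (a.2 = .rgt)

theorem rgtCount_le {l l' : List G.Fated} (h : List.Forall₂ Refines l l') :
    rgtCount l' ≤ rgtCount l ∧ (rgtCount l' = rgtCount l → l = l') := by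
  induction h with
  | nil => simp
  | @cons a b l l' hab _ ih =>
    obtain ⟨a1, a2⟩ := a
    obtain ⟨b1, b2⟩ := b
    obtain ⟨rfl : a1 = b1, h2 : a2 = .rgt ∨ a2 = b2⟩ := hab
    unfold rgtCount at ih ⊢
    simp only [List.countP_cons, decide_eq_true_eq]
    rcases h2 with rfl | rfl
    · by_cases hb : b2 = .rgt
      · subst hb
        refine ⟨by omega, fun h => ?_⟩
        rw [ih.2 (by omega)]
      · simp only [hb, decide_true, decide_false, if_true, Bool.false_eq_true, if_false]
        exact ⟨by omega, fun h => by omega⟩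
    · refine ⟨by omega, fun h => ?_⟩
      rw [ih.2 (by omega)]

/-- Everything to the right of a symbol with fate `rgt` has fate `rgt`. -/
def Cut (l : List G.Fated) : Prop := l.Pairwise fun a b => a.2 = .rgt → b.2 = .rgt

theorem cut_mark (l : List (G.N ⊕ T)) : Cut (mark l) := by
  induction l with
  | nil => exact .nil
  | cons c l ih =>
    cases c with
    | inr a => exact .cons (fun _ _ h => by cases h) ih
    | inl A =>
      have : ∀ b ∈ (mark (Sum.inl A :: l) : List G.Fated), b.2 = .rgt := by
        intro b hb
        simp only [mark, List.mem_cons, List.mem_map] at hb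
        rcases hb with rfl | ⟨c, -, rfl⟩ <;> rfl
      exact List.pairwise_of_forall_mem_list fun a _ b hb _ => this b hb

theorem Cut.rewrite {p : G.P} {A : G.N} {X Y Z : List G.Fated} (h : Cut (X ++ Y ++ Z)) :
    Cut (X ++ (Sum.inl A, comb p X Y) :: Z) := by
  obtain ⟨hXY, hZ, hc⟩ := List.pairwise_append.1 h
  obtain ⟨hX, hY, hc'⟩ := List.pairwise_append.1 hXY
  refine List.pairwise_append.2 ⟨hX, .cons (fun b hb hr => ?_) hZ, fun a ha b hb hr => ?_⟩
  · rcases comb_eq_rgt_iff.1 hr with ⟨a, ha, hr⟩ | ⟨a, ha, hr⟩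
    · exact hc a (List.mem_append_left _ ha) b hb hr
    · exact hc a (List.mem_append_right _ ha) b hb hr
  · rcases List.mem_cons.1 hb with rfl | hb
    · exact comb_eq_rgt_iff.2 (.inl ⟨a, ha, hr⟩)
    · exact hc a (List.mem_append_left _ ha) b hb hr

theorem Erases.cons_of_singleton {c : G.N ⊕ T} {l : List (G.N ⊕ T)} {M M' : Multiset G.P}
    (h : G.Erases [c] M) (h' : G.Erases l M') : G.Erases (c :: l) (M + M') := by
  cases h with
  | cons hp hr hn =>
    cases hn
    simpa [add_assoc] using Erases.cons hp hr h'

theorem erases_owed {Y : List G.Fated} (hera : ∀ a ∈ Y, ∃ M, a.2 = .era M)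
    (h : ∀ a ∈ Y, ∀ M, a.2 = .era M → G.Erases [a.1] M) :
    G.Erases (Y.map Prod.fst) (owed Y) := by
  induction Y with
  | nil => exact .nil
  | cons a Y ih =>
    obtain ⟨M, hM⟩ := hera a List.mem_cons_self
    have h1 := h a List.mem_cons_self M hM
    have h2 := ih (fun b hb => hera b (List.mem_cons_of_mem _ hb))
      fun b hb => h b (List.mem_cons_of_mem _ hb)
    simpa [owed, Fate.prods, hM] using h1.cons_of_singleton h2

theorem mem_owed {Y : List G.Fated} {q : G.P} :
    q ∈ owed Y ↔ ∃ a ∈ Y, ∃ M, a.2 = .era M ∧ q ∈ M := by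
  induction Y with
  | nil => simp [owed]
  | cons a Y ih =>
    have : q ∈ owed (a :: Y) ↔ q ∈ a.2.prods ∨ q ∈ owed Y := by simp [owed]
    rw [this, ih]
    cases h : a.2 <;> simp [h, Fate.prods]

section Fates

variable (s : ℕ → List (G.N ⊕ T)) (d : ℕ → G.P) (m : ℕ → ℕ)

/-- The fates at time `i` that can be predicted from the derivation up to time `i + n`. -/
noncomputable def fates : ℕ → ℕ → List G.Fated
  | 0, i => mark (s i)
  | n + 1, i => back (m i) (G.lhsHead (d i)) (d i) (fates n (i + 1))

/-- The nonterminal at position `m i` is rewritten at time `i` with `d i`. -/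
def RewritesAt : Prop := ∀ i, ∃ u v, u.length = m i ∧
  s i = u ++ Sum.inl (G.lhsHead (d i)) :: v ∧ s (i + 1) = u ++ G.rhs (d i) ++ v

variable {s d m}

theorem fates_map_fst (h : RewritesAt s d m) (n i : ℕ) : (fates s d m n i).map Prod.fst = s i := by
  induction n generalizing i with
  | zero => exact mark_map_fst _
  | succ n ih =>
    obtain ⟨u, v, hu, hi, hi'⟩ := h i
    rw [hi]
    exact back_map_fst ((ih (i + 1)).trans hi') hu

theorem fates_refines (h : RewritesAt s d m) (n i : ℕ) :
    List.Forall₂ Refines (fates s d m n i) (fates s d m (n + 1) i) := by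
  induction n generalizing i with
  | zero =>
    obtain ⟨u, v, hu, hi, hi'⟩ := h i
    simp only [fates, hi, hi', ← hu]
    exact refines_back_mark u v _ _
  | succ n ih => exact back_refines (ih (i + 1))

theorem Refines.trans {a b c : G.Fated} (h : Refines a b) (h' : Refines b c) : Refines a c := by
  refine ⟨h.1.trans h'.1, ?_⟩
  rcases h.2 with h2 | h2
  · exact .inl h2
  · rw [h2]; exact h'.2

theorem forall₂_refines_trans {l l' l'' : List G.Fated} (h : List.Forall₂ Refines l l')
    (h' : List.Forall₂ Refines l' l'') : List.Forall₂ Refines l l'' := by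
  induction h generalizing l'' with
  | nil => exact h'
  | cons hab _ ih =>
    cases h' with
    | cons hbc h' => exact .cons (hab.trans hbc) (ih h')

theorem fates_refines_of_le (h : RewritesAt s d m) {n k : ℕ} (hk : n ≤ k) (i : ℕ) :
    List.Forall₂ Refines (fates s d m n i) (fates s d m k i) := by
  induction hk with
  | refl => exact List.forall₂_same.2 fun a _ => ⟨rfl, .inr rfl⟩
  | step _ ih => exact forall₂_refines_trans ih (fates_refines h _ i)

theorem back_split {k : ℕ} {A : G.N} {p : G.P} {u v : List (G.N ⊕ T)} {l : List G.Fated}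
    (hl : l.map Prod.fst = u ++ G.rhs p ++ v) (hk : u.length = k) :
    ∃ X Y Z, l = X ++ Y ++ Z ∧ X.map Prod.fst = u ∧ Y.map Prod.fst = G.rhs p ∧
      back k A p l = X ++ (Sum.inl A, comb p X Y) :: Z := by
  subst hk
  refine ⟨l.take u.length, (l.drop u.length).take (G.rhs p).length,
    l.drop (u.length + (G.rhs p).length), ?_, ?_, ?_, rfl⟩
  · rw [← List.drop_drop, List.append_assoc, List.take_append_drop, List.take_append_drop]
  · simp [List.map_take, hl]
  · simp [List.map_take, List.map_drop, hl]

theorem fates_split (h : RewritesAt s d m) (n i : ℕ) :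
    ∃ X Y Z, fates s d m n (i + 1) = X ++ Y ++ Z ∧ X.length = m i ∧
      Y.map Prod.fst = G.rhs (d i) ∧
      fates s d m (n + 1) i = X ++ (Sum.inl (G.lhsHead (d i)), comb (d i) X Y) :: Z := by
  obtain ⟨u, v, hu, hi, hi'⟩ := h i
  obtain ⟨X, Y, Z, h1, h2, h3, h4⟩ :=
    back_split (A := G.lhsHead (d i)) ((fates_map_fst h n (i + 1)).trans hi') hu
  exact ⟨X, Y, Z, h1, by rw [← hu, ← h2, List.length_map], h3, h4⟩

theorem cut_fates (h : RewritesAt s d m) (n i : ℕ) : Cut (fates s d m n i) := by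
  induction n generalizing i with
  | zero => exact cut_mark _
  | succ n ih =>
    obtain ⟨X, Y, Z, h1, -, -, h4⟩ := fates_split h n i
    rw [h4]
    exact Cut.rewrite (h1 ▸ ih (i + 1))

theorem mark_ne_era {l : List (G.N ⊕ T)} {a : G.Fated} (ha : a ∈ mark l) (M : Multiset G.P) :
    a.2 ≠ .era M := by
  induction l with
  | nil => simp [mark] at ha
  | cons c l ih =>
    cases c with
    | inr t =>
      rcases List.mem_cons.1 ha with rfl | ha
      · simp
      · exact ih ha
    | inl A =>
      simp only [mark, List.mem_cons, List.mem_map] at ha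
      rcases ha with rfl | ⟨c, -, rfl⟩ <;> simp

theorem fates_era (hG : G.IsCFG) (h : RewritesAt s d m) (n i : ℕ) {a : G.Fated}
    (ha : a ∈ fates s d m n i) {M : Multiset G.P} (hM : a.2 = .era M) :
    G.Erases [a.1] M ∧ ∀ q ∈ M, ∃ t, i ≤ t ∧ d t = q := by
  induction n generalizing i a M with
  | zero => exact absurd hM (mark_ne_era ha M)
  | succ n ih =>
    obtain ⟨X, Y, Z, h1, -, h3, h4⟩ := fates_split h n i
    have hrec : ∀ b ∈ X ++ Y ++ Z, ∀ M, b.2 = .era M →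
        G.Erases [b.1] M ∧ ∀ q ∈ M, ∃ t, i ≤ t ∧ d t = q := by
      intro b hb M hM
      obtain ⟨h1, h2⟩ := ih (i + 1) (h1 ▸ hb) hM
      refine ⟨h1, fun q hq => ?_⟩
      obtain ⟨t, ht, hq⟩ := h2 q hq
      exact ⟨t, by omega, hq⟩
    rw [h4, List.mem_append, List.mem_cons] at ha
    rcases ha with ha | rfl | ha
    · exact hrec a (by simp [ha]) M hM
    · obtain ⟨-, rfl, hY⟩ := comb_eq_era hM
      refine ⟨?_, fun q hq => ?_⟩
      · have := erases_owed hY fun b hb M hM => (hrec b (by simp [hb]) M hM).1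
        rw [h3] at this
        simpa using Erases.cons (lhs_eq_of_isCFG hG (d i)) this .nil
      · rcases Multiset.mem_cons.1 hq with rfl | hq
        · exact ⟨i, le_rfl, rfl⟩
        · obtain ⟨b, hb, M, hM, hq⟩ := mem_owed.1 hq
          exact (hrec b (by simp [hb]) M hM).2 q hq
    · exact hrec a (by simp [ha]) M hM

/-- The fates at time `i` that are determined by the whole derivation. -/
theorem exists_fates_limit (h : RewritesAt s d m) :
    ∃ S : ℕ → List G.Fated, ∀ i, ∃ N, ∀ n, N ≤ n → fates s d m n i = S i := by
  have : ∀ i, ∃ l, ∃ N, ∀ n, N ≤ n → fates s d m n i = l := by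
    intro i
    let N := Function.argmin fun n => rgtCount (fates s d m n i)
    refine ⟨fates s d m N i, N, fun n hn => ?_⟩
    obtain ⟨h1, h2⟩ := rgtCount_le (fates_refines_of_le h hn i)
    exact (h2 (h1.antisymm (Function.argmin_le (fun n => rgtCount (fates s d m n i)) n))).symm
  choose S hS using this
  exact ⟨S, hS⟩

end Fates

end OmegaPSG
end OmegaFormal

namespace OmegaFormal
namespace OmegaPSG

variable {T : Type} (G : OmegaPSG T)

/-- The items that describe a sentential form of the ε-free grammar together with the sentential
form it represents: the symbol `none`, or a symbol with its fate, the productions promised at it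
and its parity. -/
inductive Item
  | dead
  | real (a : G.Fated) (R : Multiset G.P) (b : Bool)

variable {G}

/-- The symbols of the ε-free grammar that an item contributes. -/
def Item.out : G.Item → List (G.LazyN ⊕ T)
  | .dead => [Sum.inl none]
  | .real (_, .era _) _ _ => []
  | .real (Sum.inr t, _) _ _ => [Sum.inr t]
  | .real (Sum.inl A, _) R b => [Sum.inl (some (A, {q | q ∈ R}, b))]

/-- The symbols of the original grammar that an item contributes. -/
def Item.fated : G.Item → List G.Fated
  | .dead => []
  | .real a _ _ => [a]

/-- The productions promised at an item. -/
def Item.pend : G.Item → Multiset G.P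
  | .dead => 0
  | .real _ R _ => R

/-- The sentential form of the ε-free grammar. -/
def out (w : List G.Item) : List (G.LazyN ⊕ T) := w.flatMap Item.out

/-- The represented sentential form, with fates. -/
def fated (w : List G.Item) : List G.Fated := w.flatMap Item.fated

/-- All promised productions. -/
def pend (w : List G.Item) : Multiset G.P := (w.map Item.pend).sum

@[simp] theorem out_append (x y : List G.Item) : out (x ++ y) = out x ++ out y := by simp [out]
@[simp] theorem out_cons (a : G.Item) (y : List G.Item) : out (a :: y) = a.out ++ out y := by
  simp [out]
@[simp] theorem out_nil : out ([] : List G.Item) = [] := rfl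
@[simp] theorem fated_append (x y : List G.Item) : fated (x ++ y) = fated x ++ fated y := by
  simp [fated]
@[simp] theorem fated_cons (a : G.Item) (y : List G.Item) :
    fated (a :: y) = a.fated ++ fated y := by simp [fated]
@[simp] theorem fated_nil : fated ([] : List G.Item) = [] := rfl
@[simp] theorem pend_append (x y : List G.Item) : pend (x ++ y) = pend x + pend y := by
  simp [pend]
@[simp] theorem pend_cons (a : G.Item) (y : List G.Item) : pend (a :: y) = a.pend + pend y := by
  simp [pend]
@[simp] theorem pend_nil : pend ([] : List G.Item) = 0 := rfl
@[simp] theorem owed_append (x y : List G.Fated) : owed (x ++ y) = owed x + owed y := by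
  simp [owed]
@[simp] theorem owed_cons (a : G.Fated) (y : List G.Fated) :
    owed (a :: y) = a.2.prods + owed y := by simp [owed]
@[simp] theorem owed_nil : owed ([] : List G.Fated) = 0 := rfl

/-- The promises of an item are only made at nonterminals of fate `lft`. -/
def Item.Fair : G.Item → Prop
  | .dead => True
  | .real a R _ => R ≠ 0 → a.2 = .lft ∧ ∃ A, a.1 = Sum.inl A

/-- Promises are fair and the symbol `none` is only used to the right of fate `rgt`. -/
structure Tidy (w : List G.Item) : Prop where
  dead : ∀ x y, w = x ++ .dead :: y → HasRgt (fated x)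
  fair : ∀ a ∈ w, a.Fair

theorem HasRgt.append_left {l : List G.Fated} (h : HasRgt l) (l' : List G.Fated) :
    HasRgt (l ++ l') := by
  obtain ⟨a, ha, hr⟩ := h
  exact ⟨a, List.mem_append_left _ ha, hr⟩

theorem HasRgt.append_right {l : List G.Fated} (h : HasRgt l) (l' : List G.Fated) :
    HasRgt (l' ++ l) := by
  obtain ⟨a, ha, hr⟩ := h
  exact ⟨a, List.mem_append_right _ ha, hr⟩

/-- The right-hand side of a production of the ε-free grammar, from the fates of the symbols in
the original right-hand side. -/
theorem exists_annotated (b : Bool) (R : Multiset G.P) {Y : List G.Fated}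
    (hera : ∀ a ∈ Y, ∀ M, a.2 = .era M → G.Erases [a.1] M) (hcut : Cut Y)
    (hR : HasRgt Y → R = 0) :
    ∃ (l : List G.Item) (O : Multiset G.P), fated l = Y ∧
      G.Lazy {q | q ∈ R} {q | q ∈ O} (out l) (Y.map Prod.fst) ∧
      pend l + O = R + owed Y ∧ (∀ a ∈ l, a.Fair) ∧ Item.dead ∉ l ∧
      (∀ A R' b', Sum.inl (some (A, R', b')) ∈ out l → b' = b) ∧
      (out l).length ≤ Y.length ∧ ((∃ a ∈ Y, a.2 = .lft ∨ a.2 = .rgt) → out l ≠ []) ∧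
      ((∀ a ∈ Y, a.2 = .rgt) → R = 0 → O = 0) := by
  induction Y with
  | nil =>
    exact ⟨[], R, rfl, .nil, by simp, by simp, by simp, by simp, by simp, by simp, by simp⟩
  | cons a Y ih =>
    obtain ⟨hrgt, hcut⟩ := List.pairwise_cons.1 hcut
    obtain ⟨l, O, h1, h2, h3, h4, h5, h6, h7, h8, h9⟩ :=
      ih (fun a ha => hera a (List.mem_cons_of_mem _ ha)) hcut
        fun h => hR (h.append_right [a])
    have hera := hera a List.mem_cons_self
    obtain ⟨c, f⟩ := a
    cases f with
    | era M =>
      have hE := hera M rfl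
      refine ⟨.real (c, .era M) 0 b :: l, M + O, by simp [Item.fated, h1], ?_, ?_, ?_, by simp [h5],
        by simpa [Item.out] using h6, ?_, ?_, fun h => by simpa using h (c, .era M)⟩
      · have hc : ∃ A, c = Sum.inl A := by
          cases hE with
          | @cons _ A => exact ⟨A, rfl⟩
        obtain ⟨A, rfl⟩ := hc
        have hU : {q | q ∈ M + O} = {q | q ∈ M} ∪ {q | q ∈ O} := by ext; simp
        rw [hU]
        exact .erased hE h2
      · simp only [pend_cons, Item.pend, owed_cons, Fate.prods, zero_add]
        rw [add_left_comm, h3, add_left_comm]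
      · simpa [Item.Fair] using h4
      · simp only [out_cons, Item.out, List.nil_append, List.length_cons]
        omega
      · rintro ⟨a, ha, hf⟩
        rcases List.mem_cons.1 ha with rfl | ha
        · simp at hf
        · simpa [Item.out] using h8 ⟨a, ha, hf⟩
    | lft =>
      cases c with
      | inr t =>
        refine ⟨.real (Sum.inr t, .lft) 0 b :: l, O, by simp [Item.fated, h1], .term t h2,
          by simpa [Item.pend, Fate.prods] using h3, by simpa [Item.Fair] using h4, by simp [h5],
          by simpa [Item.out] using h6, by simpa [Item.out] using h7, by simp [Item.out],
          fun h => by simpa using h (Sum.inr t, .lft)⟩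
      | inl A =>
        refine ⟨.real (Sum.inl A, .lft) O b :: l, 0, by simp [Item.fated, h1], ?_,
          by simpa [Item.pend, Fate.prods, add_comm] using h3, by simpa [Item.Fair] using h4,
          by simp [h5], ?_, by simpa [Item.out] using h7, by simp [Item.out], fun _ _ => rfl⟩
        · simpa using! Lazy.kept A b h2
        · intro A' R' b' hm
          simp only [out_cons, Item.out, List.cons_append, List.nil_append, List.mem_cons,
            Sum.inl.injEq, Option.some.injEq, Prod.mk.injEq] at hm
          rcases hm with ⟨-, -, h⟩ | h
          · exact h
          · exact h6 A' R' b' h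
    | rgt =>
      have hR0 : R = 0 := hR ⟨_, List.mem_cons_self, rfl⟩
      have hO : O = 0 := h9 (fun a ha => hrgt a ha rfl) hR0
      cases c with
      | inr t =>
        refine ⟨.real (Sum.inr t, .rgt) 0 b :: l, O, by simp [Item.fated, h1], .term t h2,
          by simpa [Item.pend, Fate.prods] using h3, by simpa [Item.Fair] using h4, by simp [h5],
          by simpa [Item.out] using h6, by simpa [Item.out] using h7, by simp [Item.out],
          fun _ _ => hO⟩
      | inl A =>
        refine ⟨.real (Sum.inl A, .rgt) O b :: l, 0, by simp [Item.fated, h1], ?_,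
          by simpa [Item.pend, Fate.prods, add_comm] using h3,
          by simpa [Item.Fair, hO] using h4,
          by simp [h5], ?_, by simpa [Item.out] using h7, by simp [Item.out], fun _ _ => rfl⟩
        · simpa using! Lazy.kept A b h2
        · intro A' R' b' hm
          simp only [out_cons, Item.out, List.cons_append, List.nil_append, List.mem_cons,
            Sum.inl.injEq, Option.some.injEq, Prod.mk.injEq] at hm
          rcases hm with ⟨-, -, h⟩ | h
          · exact h
          · exact h6 A' R' b' h

theorem exists_item_of_fated {w : List G.Item} {X Z : List G.Fated} {a : G.Fated}
    (h : fated w = X ++ a :: Z) :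
    ∃ x R b y, w = x ++ .real a R b :: y ∧ fated x = X ∧ fated y = Z := by
  induction w generalizing X with
  | nil => simp at h
  | cons c w ih =>
    cases c with
    | dead =>
      obtain ⟨x, R, b, y, rfl, hx, hy⟩ := ih (X := X) (by simpa [Item.fated] using h)
      exact ⟨.dead :: x, R, b, y, rfl, by simpa [Item.fated] using hx, hy⟩
    | real a' R b =>
      cases X with
      | nil =>
        simp only [fated_cons, Item.fated, List.cons_append, List.nil_append,
          List.cons.injEq] at h
        obtain ⟨rfl, rfl⟩ := h
        exact ⟨[], R, b, w, rfl, rfl, rfl⟩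
      | cons a'' X =>
        simp only [fated_cons, Item.fated, List.cons_append, List.nil_append,
          List.cons.injEq] at h
        obtain ⟨rfl, h⟩ := h
        obtain ⟨x, R', b', y, rfl, hx, hy⟩ := ih h
        exact ⟨.real a' R b :: x, R', b', y, rfl, by simp [Item.fated, hx], hy⟩

/-- In the absence of `none`, an item list for terminals of fate `lft` is terminal. -/
theorem out_eq_of_terminal {w : List G.Item} (hd : Item.dead ∉ w)
    (h : ∀ a ∈ fated w, a.2 = .lft ∧ ∃ t, a.1 = Sum.inr t) :
    ∃ z : List T, out w = z.map Sum.inr ∧ (fated w).map Prod.fst = z.map Sum.inr := by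
  induction w with
  | nil => exact ⟨[], rfl, rfl⟩
  | cons c w ih =>
    cases c with
    | dead => simp at hd
    | real a R b =>
      obtain ⟨z, h1, h2⟩ := ih (fun h => hd (List.mem_cons_of_mem _ h))
        fun a ha => h a (by simp [ha])
      obtain ⟨c, f⟩ := a
      obtain ⟨rfl : f = _, t, rfl : c = _⟩ := h (c, f) (by simp [Item.fated])
      exact ⟨t :: z, by simp [Item.out, h1], by simp [Item.fated, h2]⟩

theorem Tidy.dead_notMem_left {x y : List G.Item} (h : Tidy (x ++ y))
    (hx : ¬ HasRgt (fated x)) : Item.dead ∉ x := by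
  intro hd
  obtain ⟨x1, x2, rfl⟩ := List.append_of_mem hd
  refine hx ?_
  rw [fated_append]
  exact (h.dead x1 (x2 ++ y) (by simp)).append_left _

theorem Tidy.fair_middle {x y : List G.Item} {a : G.Fated} {R : Multiset G.P} {b : Bool}
    (h : Tidy (x ++ .real a R b :: y)) (hR : R ≠ 0) : a.2 = .lft ∧ ∃ A, a.1 = Sum.inl A :=
  h.fair (.real a R b) (by simp) hR

theorem Tidy.rewrite {x y l : List G.Item} {a : G.Item} (h : Tidy (x ++ a :: y))
    (hfair : ∀ c ∈ l, c.Fair)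
    (hdead : ∀ l₁ l₂, l = l₁ ++ .dead :: l₂ → HasRgt (fated (x ++ l₁)))
    (hrgt : HasRgt (fated (x ++ [a])) → HasRgt (fated (x ++ l))) : Tidy (x ++ l ++ y) := by
  constructor
  · intro z z' hz
    rw [List.append_assoc, List.append_eq_append_iff] at hz
    rcases hz with ⟨l', rfl, hz⟩ | ⟨l', rfl, hz⟩
    · rw [List.append_eq_append_iff] at hz
      rcases hz with ⟨l'', rfl, hz⟩ | ⟨l'', rfl, hz⟩
      · have := h.dead (x ++ a :: l'') z' (by simp [hz])
        rw [show x ++ a :: l'' = (x ++ [a]) ++ l'' by simp, fated_append] at this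
        obtain ⟨c, hc, hr⟩ := this
        rw [← List.append_assoc, fated_append]
        rcases List.mem_append.1 hc with hc | hc
        · exact (hrgt ⟨c, hc, hr⟩).append_left _
        · exact HasRgt.append_right ⟨c, hc, hr⟩ _
      · cases l'' with
        | nil =>
          simp only [List.nil_append] at hz
          have := h.dead (x ++ [a]) z' (by simp [hz])
          simpa using hrgt this
        | cons c l'' =>
          simp only [List.cons_append, List.cons.injEq] at hz
          obtain ⟨rfl, -⟩ := hz
          exact hdead l' l'' rfl
    · cases l' with
      | nil =>
        simp only [List.nil_append] at hz
        cases l with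
        | nil =>
          have := h.dead (z ++ [a]) z' (by simpa using hz.symm)
          simpa using hrgt (by simpa using this)
        | cons c l =>
          simp only [List.cons_append, List.cons.injEq] at hz
          obtain ⟨rfl, -⟩ := hz
          simpa using hdead [] l rfl
      | cons c l' =>
        simp only [List.cons_append, List.cons.injEq] at hz
        obtain ⟨rfl, -⟩ := hz
        exact h.dead z (l' ++ a :: y) (by simp)
  · intro c hc
    simp only [List.mem_append] at hc
    rcases hc with (hc | hc) | hc
    · exact h.fair c (by simp [hc])
    · exact hfair c hc
    · exact h.fair c (by simp [hc])

end OmegaPSG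
end OmegaFormal

namespace OmegaFormal
namespace OmegaPSG

variable {T : Type} {G : OmegaPSG T}

/-- The counterpart in the ε-free grammar of a step with `p`, where `O` collects the productions
of the erasures carried out along with it. -/
def Counterpart [Finite T] (π : DerivMode) (p : G.P) (w w' : List G.Item) (O : Multiset G.P) :
    Option G.LazyProd → Prop
  | none => out w' = out w ∧ pend w' = pend w ∧ O = 0 ∧ owed (fated w) = p ::ₘ owed (fated w')
  | some c => G.lazyGrammar.StepOf π c (out w) (out w') ∧ c.used = insert p {q | q ∈ O} ∧
      pend w' + O + owed (fated w) = pend w + owed (fated w')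

/-- A step of the original grammar with production `p` at position `m`, with its counterpart in
the ε-free grammar: none if the rewritten symbol is erased, and `c` otherwise. -/
def ItemStep [Finite T] (π : DerivMode) (p : G.P) (m : ℕ) (w w' : List G.Item)
    (o : Option G.LazyProd) : Prop :=
  ∃ x a y l O, w = x ++ a :: y ∧ w' = x ++ l ++ y ∧ (fated x).length = m ∧
    a.fated.length = 1 ∧ (fated l).length = (G.rhs p).length ∧ a.pend ≤ pend l + O ∧
    Counterpart π p w w' O o

theorem exists_itemStep_of_era [Finite T] {π : DerivMode} {p : G.P} {X Y Z : List G.Fated}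
    {w : List G.Item} {A : G.N} {M : Multiset G.P} (hw : Tidy w)
    (hf : fated w = X ++ (Sum.inl A, comb p X Y) :: Z)
    (hY : Y.map Prod.fst = G.rhs p) (hM : comb p X Y = .era M) :
    ∃ w', (Tidy w' ∧ fated w' = X ++ Y ++ Z) ∧ ItemStep π p X.length w w' none := by
  obtain ⟨x, R, b, y, rfl, rfl, rfl⟩ := exists_item_of_fated hf
  obtain ⟨hX, rfl, hera⟩ := comb_eq_era hM
  have hR : R = 0 := by
    by_contra hR
    have := (hw.fair_middle hR).1
    rw [hM] at this
    cases this
  subst hR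
  rw [hM] at hf hw ⊢
  let l : List G.Item := Y.map fun a => .real a 0 false
  have hfl : fated l = Y := by
    simp [l, fated, List.flatMap_map, Item.fated]
  have hol : out l = [] := by
    simp only [l, out, List.flatMap_map, List.flatMap_eq_nil_iff]
    rintro ⟨c, f⟩ ha
    obtain ⟨M, rfl : f = _⟩ := hera _ ha
    rfl
  have hpl : pend l = 0 := by
    simp [l, pend, Function.comp_def, Item.pend]
  refine ⟨x ++ l ++ y, ⟨hw.rewrite ?_ ?_ ?_, by simp [hfl]⟩, x, _, y, l, 0, rfl, rfl, rfl, rfl,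
    by rw [hfl, ← hY, List.length_map], by simp [Item.pend], ?_, ?_, rfl, ?_⟩
  · intro c hc
    obtain ⟨a, -, rfl⟩ := List.mem_map.1 hc
    exact fun h => absurd rfl h
  · intro l₁ l₂ hl
    have : Item.dead ∈ l := by simp [hl]
    simp [l] at this
  · rintro ⟨c, hc, hr⟩
    simp only [fated_append, fated_cons, Item.fated, fated_nil, List.append_nil,
      List.mem_append, List.mem_singleton] at hc
    rcases hc with hc | rfl
    · exact absurd ⟨c, hc, hr⟩ hX
    · cases hr
  · simp [hol, Item.out]
  · simp [hpl, Item.pend]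
  · simp only [fated_append, fated_cons, Item.fated, hfl, owed_append, owed_cons, Fate.prods,
      List.cons_append, List.nil_append]
    simp only [← Multiset.singleton_add]
    ac_rfl

theorem exists_itemStep_of_kept [Finite T] {π : DerivMode} {p : G.P} {X Y Z : List G.Fated}
    {w : List G.Item} (hw : Tidy w)
    (hf : fated w = X ++ (Sum.inl (G.lhsHead p), comb p X Y) :: Z)
    (hY : Y.map Prod.fst = G.rhs p) (hcut : Cut Y)
    (hera : ∀ a ∈ Y, ∀ M, a.2 = .era M → G.Erases [a.1] M)
    (hπ : π = .l → ∀ a ∈ X, a.2 = .lft ∧ ∃ t, a.1 = Sum.inr t)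
    (hkept : comb p X Y = .lft ∨ comb p X Y = .rgt) :
    ∃ w' c, (Tidy w' ∧ fated w' = X ++ Y ++ Z) ∧ ItemStep π p X.length w w' (some c) := by
  classical
  obtain ⟨x, R, b, y, rfl, rfl, rfl⟩ := exists_item_of_fated hf
  have hR : HasRgt Y → R = 0 := by
    intro h
    by_contra hR
    have h1 := (hw.fair_middle hR).1
    rw [comb_eq_rgt_iff.2 (.inr h)] at h1
    cases h1
  obtain ⟨l, O, h1, h2, h3, h4, h5, h6, h7, h8, -⟩ := exists_annotated (!b) R hera hcut hR
  have hYne : ¬ HasRgt (fated x) → ∃ a ∈ Y, a.2 = .lft ∨ a.2 = .rgt := by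
    intro hx
    rcases hkept with h | h
    · obtain ⟨-, -, a, ha, hl⟩ := comb_eq_lft h
      exact ⟨a, ha, .inl hl⟩
    · obtain ⟨a, ha, hr⟩ := (comb_eq_rgt_iff.1 h).resolve_left hx
      exact ⟨a, ha, .inr hr⟩
  obtain ⟨l', hl'⟩ : ∃ l', l' = if HasRgt (fated x) then Item.dead :: l else l := ⟨_, rfl⟩
  have hfl : fated l' = Y := by
    rw [hl']; split_ifs <;> simp [Item.fated, h1]
  have hpl : pend l' = pend l := by
    rw [hl']; split_ifs <;> simp [Item.pend]
  have hout : (Item.real (Sum.inl (G.lhsHead p), comb p (fated x) Y) R b).out =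
      [Sum.inl (some (G.lhsHead p, {q | q ∈ R}, b))] := by
    rcases hkept with h | h <;> rw [h] <;> rfl
  have hprods : (comb p (fated x) Y).prods = 0 := by
    rcases hkept with h | h <;> rw [h] <;> rfl
  let c : G.LazyProd :=
    { prod := p
      promised := {q | q ∈ R}
      parity := b
      erasing := {q | q ∈ O}
      body := out l'
      lazy := by
        rw [hl', ← hY]
        split_ifs
        · exact .dead h2
        · exact h2
      body_ne := by
        rw [hl']
        split_ifs with hx
        · simp [Item.out]
        · exact h8 (hYne hx)
      length_le := by
        rw [hl', ← hY, List.length_map]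
        split_ifs
        · simpa [Item.out] using h7
        · omega
      parity_ne := by
        intro A R' b' hm
        have : b' = !b := by
          refine h6 A R' b' ?_
          rw [hl'] at hm
          split_ifs at hm
          · simpa [Item.out] using hm
          · exact hm
        simp [this] }
  refine ⟨x ++ l' ++ y, c, ⟨hw.rewrite ?_ ?_ ?_, by simp [hfl]⟩, x, _, y, l', O, rfl, rfl, rfl,
    rfl, by rw [hfl, ← hY, List.length_map], ?_, ?_, rfl, ?_⟩
  · rw [hl']
    split_ifs
    · intro c hc
      rcases List.mem_cons.1 hc with rfl | hc
      · trivial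
      · exact h4 c hc
    · exact h4
  · intro l₁ l₂ hl
    rw [fated_append]
    by_cases hx : HasRgt (fated x)
    · exact hx.append_left _
    · rw [hl', if_neg hx] at hl
      exact absurd (by simp [hl]) h5
  · rintro ⟨a, ha, hr⟩
    rw [fated_append, hfl]
    simp only [fated_append, fated_cons, Item.fated, fated_nil, List.append_nil,
      List.mem_append, List.mem_singleton] at ha
    rcases ha with ha | rfl
    · exact HasRgt.append_left ⟨a, ha, hr⟩ _
    · rcases comb_eq_rgt_iff.1 hr with h | h
      · exact h.append_left _
      · exact h.append_right _
  · rw [hpl, h3]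
    exact Multiset.le_add_right _ _
  · refine stepOf_iff.2 ⟨out x, out y, fun h => ?_, ?_, ?_⟩
    · have hX := hπ h
      have hd : Item.dead ∉ x := hw.dead_notMem_left fun ⟨a, ha, hr⟩ => by
        rw [(hX a ha).1] at hr
        cases hr
      obtain ⟨z, hz, -⟩ := out_eq_of_terminal hd hX
      rw [hz]
      intro s hs
      obtain ⟨t, -, rfl⟩ := List.mem_map.1 hs
      exact ⟨t, rfl⟩
    · rw [out_append, out_cons, hout]
      exact (List.append_assoc _ _ _).symm
    · rw [out_append, out_append]
      rfl
  · simp only [fated_append, fated_cons, pend_append, pend_cons, owed_append, Item.fated,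
      Item.pend, hfl, hpl, owed_cons, hprods, owed_nil]
    have : pend x + pend l + pend y + O = pend x + pend y + (pend l + O) := by ac_rfl
    rw [this, h3]
    simp only [zero_add, add_zero]
    ac_rfl

end OmegaPSG
end OmegaFormal

namespace OmegaFormal

/-- Events that strictly decrease a nonincreasing natural number come to an end. -/
theorem exists_last_event {Φ : ℕ → ℕ} {E : ℕ → Prop} {t : ℕ}
    (h : ∀ i, t ≤ i → Φ (i + 1) ≤ Φ i ∧ (E i → Φ (i + 1) < Φ i)) :
    (∃ t', ∀ i, t' ≤ i → ¬ E i) ∧ (Φ t = 0 → ∀ i, t ≤ i → ¬ E i) := by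
  have hmono : ∀ i j, t ≤ i → i ≤ j → Φ j ≤ Φ i := fun i j hi hj => by
    induction hj with
    | refl => exact le_rfl
    | @step j hj ih => exact (h j (hi.trans hj)).1.trans ih
  have hmin : ∀ t', t ≤ t' → (∀ i, t ≤ i → Φ t' ≤ Φ i) → ∀ i, t' ≤ i → ¬ E i := by
    intro t' ht hmin i hi hE
    have h1 := (h i (ht.trans hi)).2 hE
    have h2 := hmin (i + 1) (by omega)
    have h3 := hmono t' i ht hi
    omega
  refine ⟨?_, fun h0 => hmin t le_rfl fun i _ => by omega⟩
  let k := Function.argmin fun k => Φ (t + k)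
  refine ⟨t + k, hmin (t + k) (by omega) fun i hi => ?_⟩
  obtain ⟨j, rfl⟩ := Nat.exists_eq_add_of_le hi
  exact Function.argmin_le (fun k => Φ (t + k)) j

theorem sigmaSet_eq_limSet_of_iff {Q : Type*} {d : ℕ → Q} {C : ℕ → Set Q}
    (h₁ : ∀ q t, (∀ i, t ≤ i → d i ≠ q) →
      (∃ t', ∀ i, t' ≤ i → q ∉ C i) ∧ (t = 0 → ∀ i, q ∉ C i))
    (h₂ : ∀ q t, (∀ i, t ≤ i → q ∉ C i) →
      (∃ t', ∀ i, t' ≤ i → d i ≠ q) ∧ (t = 0 → ∀ i, d i ≠ q))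
    (σ : AccSigma) : sigmaSet σ d = limSet σ C := by
  ext q
  cases σ with
  | ran =>
    simp only [sigmaSet, limSet, Set.mem_range, Set.mem_ofPred_eq]
    constructor
    · contrapose!
      exact fun h => (h₂ q 0 fun i _ => h i).2 rfl
    · contrapose!
      exact fun h => (h₁ q 0 fun i _ => h i).2 rfl
  | inf =>
    simp only [sigmaSet, limSet, Set.mem_ofPred_eq]
    constructor
    · contrapose!
      rintro ⟨t, h⟩
      exact (h₂ q t h).1
    · contrapose!
      rintro ⟨t, h⟩
      exact (h₁ q t h).1

namespace OmegaPSG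

variable {T : Type} {G : OmegaPSG T}

theorem exists_eq_of_refines_mark {z : List T} {r : List (G.N ⊕ T)} {S : List G.Fated}
    (h : List.Forall₂ Refines (mark (z.map Sum.inr ++ r)) S) :
    ∃ S', S = z.map (fun t => (Sum.inr t, .lft)) ++ S' := by
  induction z generalizing S with
  | nil => exact ⟨S, rfl⟩
  | cons t z ih =>
    cases h with
    | @cons _ b _ S hab h =>
      obtain ⟨S', rfl⟩ := ih h
      obtain ⟨b1, b2⟩ := b
      obtain ⟨rfl : Sum.inr t = b1, hf⟩ := hab
      have : b2 = .lft := by simpa [eq_comm] using hf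
      exact ⟨S', by simp [this]⟩

theorem exists_eq_termPrefix_append {N : Type} (l : List (N ⊕ T)) :
    ∃ r, l = (termPrefix l).map Sum.inr ++ r := by
  induction l with
  | nil => exact ⟨[], rfl⟩
  | cons c l ih =>
    cases c with
    | inl A => exact ⟨_, rfl⟩
    | inr t =>
      obtain ⟨r, hr⟩ := ih
      exact ⟨r, by simp [termPrefix, ← hr]⟩

theorem prefix_termPrefix_append {N : Type} (z : List T) (r : List (N ⊕ T)) :
    z <+: termPrefix (z.map Sum.inr ++ r) := by
  induction z with
  | nil => simp
  | cons t z ih => simpa [termPrefix] using ih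

theorem exists_eq_append_of_fated_eq {w : List G.Item} {X Z : List G.Fated}
    (h : fated w = X ++ Z) : ∃ x y, w = x ++ y ∧ fated x = X ∧ fated y = Z := by
  cases Z with
  | nil => exact ⟨w, [], by simp, by simpa using h, rfl⟩
  | cons a Z =>
    obtain ⟨x, R, b, y, rfl, hx, hy⟩ := exists_item_of_fated h
    exact ⟨x, .real a R b :: y, rfl, hx, by simp [Item.fated, hy]⟩

theorem Tidy.termPrefix_mono {w : List G.Item} (hw : Tidy w) {s : List (G.N ⊕ T)}
    (h : List.Forall₂ Refines (mark s) (fated w)) : termPrefix s <+: termPrefix (out w) := by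
  obtain ⟨r, hr⟩ := exists_eq_termPrefix_append s
  generalize termPrefix s = z at hr
  subst hr
  obtain ⟨S', hS⟩ := exists_eq_of_refines_mark h
  obtain ⟨x, y, rfl, hx, -⟩ := exists_eq_append_of_fated_eq hS
  have hterm : ∀ a ∈ fated x, a.2 = .lft ∧ ∃ t, a.1 = Sum.inr t := by
    rw [hx]
    intro a ha
    obtain ⟨t, -, rfl⟩ := List.mem_map.1 ha
    exact ⟨rfl, t, rfl⟩
  have hd : Item.dead ∉ x := hw.dead_notMem_left fun ⟨a, ha, hr⟩ => by
    rw [(hterm a ha).1] at hr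
    cases hr
  obtain ⟨z', h1, h2⟩ := out_eq_of_terminal hd hterm
  have : z = z' := by
    rw [hx] at h2
    simp only [List.map_map, Function.comp_def] at h2
    exact List.map_injective_iff.2 Sum.inr_injective h2
  rw [out_append, h1, this]
  exact prefix_termPrefix_append _ _

theorem exists_item_of_mem_pend {x : List G.Item} {q : G.P} (h : q ∈ pend x) :
    ∃ a ∈ x, q ∈ a.pend := by
  induction x with
  | nil => simp at h
  | cons a x ih =>
    rcases Multiset.mem_add.1 (pend_cons a x ▸ h) with h | h
    · exact ⟨a, List.mem_cons_self, h⟩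
    · obtain ⟨b, hb, hq⟩ := ih h
      exact ⟨b, List.mem_cons_of_mem _ hb, hq⟩

theorem mark_nonterminal {l : List (G.N ⊕ T)} {a : G.Fated} (ha : a ∈ mark l) {A : G.N}
    (hA : a.1 = Sum.inl A) : a.2 = .rgt := by
  induction l with
  | nil => simp [mark] at ha
  | cons c l ih =>
    cases c with
    | inr t =>
      rcases List.mem_cons.1 ha with rfl | ha
      · simp at hA
      · exact ih ha
    | inl B =>
      simp only [mark, List.mem_cons, List.mem_map] at ha
      rcases ha with rfl | ⟨c, -, rfl⟩ <;> rfl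

section Trace

variable [Finite T] {π : DerivMode} {s : ℕ → List (G.N ⊕ T)} {d : ℕ → G.P} {m : ℕ → ℕ}
  {S : ℕ → List G.Fated} {w : ℕ → List G.Item} {o : ℕ → Option G.LazyProd}

/-- The original productions simulated at time `i`. -/
def claimed (o : ℕ → Option G.LazyProd) (i : ℕ) : Set G.P := {q | ∃ c, o i = some c ∧ q ∈ c.used}

theorem exists_claimed_of_pend_split (h : RewritesAt s d m)
    (hw : ∀ i, Tidy (w i) ∧ (fated (w i)).map Prod.fst = s i)
    (hstep : ∀ i, ItemStep π (d i) (m i) (w i) (w (i + 1)) (o i)) {q : G.P} (n i : ℕ)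
    {x y : List G.Item} (hxy : w i = x ++ y)
    (hr : ¬ HasRgt ((fates s d m n i).take (fated x).length)) (hq : q ∈ pend x) :
    ∃ j, i ≤ j ∧ q ∈ claimed o j := by
  induction n generalizing i x y with
  | zero =>
    exfalso
    obtain ⟨a, ha, hqa⟩ := exists_item_of_mem_pend hq
    cases a with
    | dead => simp [Item.pend] at hqa
    | real a R b =>
      have hfair := (hw i).1.fair (.real a R b) (by simp [hxy, ha])
      obtain ⟨-, A, hA⟩ := hfair (by rintro rfl; simp [Item.pend] at hqa)
      have hfst : (fated x).map Prod.fst = (s i).take (fated x).length := by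
        rw [← (hw i).2, hxy]
        simp
      have hmem : Sum.inl A ∈ ((mark (s i)).take (fated x).length).map Prod.fst := by
        rw [List.map_take, mark_map_fst, ← hfst, ← hA]
        exact List.mem_map_of_mem (List.mem_flatMap.2 ⟨_, ha, by simp [Item.fated]⟩)
      obtain ⟨c, hc, hcA⟩ := List.mem_map.1 hmem
      exact hr ⟨c, hc, mark_nonterminal (List.mem_of_mem_take hc) hcA⟩
  | succ n ih =>
    obtain ⟨x', a, y', l, O, hi, hi', hm, ha, hl, hle, ho⟩ := hstep i
    obtain ⟨X, Y, Z, hX, hXm, hY, hXA⟩ := fates_split h n i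
    have hYl : Y.length = (G.rhs (d i)).length := by rw [← hY, List.length_map]
    have hbefore : ∀ c, x' = x ++ c → ∃ j, i ≤ j ∧ q ∈ claimed o j := by
      rintro c rfl
      have hk : (fated x).length ≤ X.length := by rw [hXm, ← hm]; simp
      obtain ⟨j, hj, hc⟩ := ih (i + 1) (x := x) (y := c ++ l ++ y') (by simp [hi']) (by
        rw [hXA, List.take_append_of_le_length hk] at hr
        rwa [hX, List.append_assoc, List.take_append_of_le_length hk]) hq
      exact ⟨j, by omega, hc⟩
    rw [hi, List.append_eq_append_iff] at hxy
    rcases hxy with ⟨c, rfl, hc⟩ | ⟨c, hc, -⟩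
    · cases c with
      | nil => exact hbefore [] (by simp)
      | cons a' c =>
        simp only [List.cons_append, List.cons.injEq] at hc
        obtain ⟨rfl, rfl⟩ := hc
        rw [hXA] at hr
        have hk : (fated (x' ++ a :: c)).length = X.length + ((fated c).length + 1) := by
          simp [hm, hXm, ha, Nat.add_comm]
        rw [hk, List.take_length_add_append, List.take_succ_cons] at hr
        have hX0 : ¬ HasRgt X := fun h => hr (h.append_left _)
        have hY0 : ¬ HasRgt Y := fun h =>
          hr ⟨_, List.mem_append_right _ List.mem_cons_self, comb_eq_rgt_iff.2 (.inr h)⟩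
        by_cases hO : q ∈ O
        · refine ⟨i, le_rfl, ?_⟩
          cases hoi : o i with
          | none =>
            rw [hoi] at ho
            simp [ho.2.2.1] at hO
          | some c =>
            rw [hoi] at ho
            exact ⟨c, hoi, by rw [ho.2.1]; exact .inr hO⟩
        obtain ⟨j, hj, hc⟩ := ih (i + 1) (x := x' ++ l ++ c) (y := y) (by simp [hi']) (by
          have hk' : (fated (x' ++ l ++ c)).length = (X ++ Y).length + (fated c).length := by
            simp [hm, hXm, hl, hYl, Nat.add_assoc]
          rw [hX, hk', List.take_length_add_append]
          rintro ⟨b, hb, hbr⟩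
          simp only [List.mem_append] at hb
          rcases hb with (hb | hb) | hb
          · exact hX0 ⟨b, hb, hbr⟩
          · exact hY0 ⟨b, hb, hbr⟩
          · exact hr ⟨b, by simp [hb], hbr⟩) (by
          simp only [pend_append, pend_cons, Multiset.mem_add] at hq ⊢
          rcases hq with hq | hq | hq
          · simp [hq]
          · have := Multiset.mem_of_le hle hq
            simp only [Multiset.mem_add] at this
            simp [this.resolve_right hO]
          · simp [hq])
        exact ⟨j, by omega, hc⟩
    · exact hbefore c hc

theorem exists_claimed_of_pend (h : RewritesAt s d m)
    (hS : ∀ i, ∃ N, ∀ n, N ≤ n → fates s d m n i = S i)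
    (hw : ∀ i, Tidy (w i) ∧ fated (w i) = S i)
    (hstep : ∀ i, ItemStep π (d i) (m i) (w i) (w (i + 1)) (o i)) {q : G.P} {i : ℕ}
    (hq : q ∈ pend (w i)) : ∃ j, i ≤ j ∧ q ∈ claimed o j := by
  obtain ⟨a, ha, hqa⟩ := exists_item_of_mem_pend hq
  obtain ⟨x, y, hxy⟩ := List.append_of_mem ha
  cases a with
  | dead => simp [Item.pend] at hqa
  | real a R b =>
    obtain ⟨N, hN⟩ := hS i
    have hN := hN N le_rfl
    have hfair := (hw i).1.fair _ ha
    have hlft := (hfair (by rintro rfl; simp [Item.pend] at hqa)).1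
    have hfst : ∀ j, (fated (w j)).map Prod.fst = s j := fun j => by
      obtain ⟨N, hN⟩ := hS j
      rw [(hw j).2, ← hN N le_rfl, fates_map_fst h]
    refine exists_claimed_of_pend_split h (fun j => ⟨(hw j).1, hfst j⟩) hstep N i
      (x := x ++ [.real a R b]) (y := y) (by simp [hxy]) ?_ ?_
    · have hcut := cut_fates h N i
      rw [hN, ← (hw i).2, hxy, fated_append, fated_cons, Item.fated] at hcut
      rw [hN, ← (hw i).2, hxy, show x ++ .real a R b :: y = (x ++ [.real a R b]) ++ y by simp,
        fated_append _ y, List.take_left]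
      rintro ⟨c, hc, hr⟩
      simp only [fated_append, fated_cons, Item.fated, fated_nil, List.append_nil,
        List.mem_append, List.mem_singleton] at hc
      have har : a.2 = .rgt := by
        rcases hc with hc | rfl
        · exact (List.pairwise_append.1 hcut).2.2 c hc a (by simp) hr
        · exact hr
      rw [har] at hlft
      cases hlft
    · simp only [pend_append, pend_cons, Multiset.mem_add]
      exact .inr (.inl hqa)

theorem sigmaSet_eq_limSet_claimed (hG : G.IsCFG) (h : RewritesAt s d m)
    (hS : ∀ i, ∃ N, ∀ n, N ≤ n → fates s d m n i = S i)
    (hw : ∀ i, Tidy (w i) ∧ fated (w i) = S i)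
    (hstep : ∀ i, ItemStep π (d i) (m i) (w i) (w (i + 1)) (o i))
    (hpend : pend (w 0) = 0) (howed : owed (fated (w 0)) = 0) (σ : AccSigma) :
    sigmaSet σ d = limSet σ (claimed o) := by
  classical
  have howes : ∀ i q, q ∈ owed (fated (w i)) → ∃ t, i ≤ t ∧ d t = q := by
    intro i q hq
    obtain ⟨N, hN⟩ := hS i
    rw [(hw i).2, ← hN N le_rfl] at hq
    obtain ⟨a, ha, M, hM, hq⟩ := mem_owed.1 hq
    exact (fates_era hG h N i ha hM).2 q hq
  refine sigmaSet_eq_limSet_of_iff (fun q t hq => ?_) (fun q t hq => ?_) σ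
  · have h0 : ∀ i, t ≤ i → (owed (fated (w i))).count q = 0 := by
      intro i hi
      rw [Multiset.count_eq_zero]
      intro hm
      obtain ⟨t', ht', hd⟩ := howes i q hm
      exact hq t' (hi.trans ht') hd
    obtain ⟨h1, h2⟩ := exists_last_event (Φ := fun i => (pend (w i)).count q)
      (E := fun i => q ∈ claimed o i) (t := t) (fun i hi => by
        obtain ⟨_, _, _, _, O, -, -, -, -, -, -, ho⟩ := hstep i
        cases hoi : o i with
        | none =>
          rw [hoi] at ho
          exact ⟨by rw [ho.2.1], fun ⟨c, hc, _⟩ => by simp [hoi] at hc⟩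
        | some c =>
          rw [hoi] at ho
          have h1 := congrArg (Multiset.count q) ho.2.2
          simp only [Multiset.count_add, h0 i hi, h0 (i + 1) (by omega)] at h1
          refine ⟨by omega, fun ⟨c', hc', hqc⟩ => ?_⟩
          obtain rfl : c = c' := by simpa [hoi] using hc'
          rw [ho.2.1] at hqc
          rcases hqc with rfl | hqO
          · exact absurd rfl (hq i hi)
          · have := Multiset.count_pos.2 hqO
            omega)
    refine ⟨h1, ?_⟩
    rintro rfl i
    exact h2 (by simp [hpend]) i (Nat.zero_le i)
  · have h0 : ∀ i, t ≤ i → (pend (w i)).count q = 0 := by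
      intro i hi
      rw [Multiset.count_eq_zero]
      intro hm
      obtain ⟨j, hj, hc⟩ := exists_claimed_of_pend h hS hw hstep hm
      exact hq j (hi.trans hj) hc
    obtain ⟨h1, h2⟩ := exists_last_event (Φ := fun i => (owed (fated (w i))).count q)
      (E := fun i => d i = q) (t := t) (fun i hi => by
        obtain ⟨_, _, _, _, O, -, -, -, -, -, -, ho⟩ := hstep i
        cases hoi : o i with
        | none =>
          rw [hoi] at ho
          rw [ho.2.2.2]
          exact ⟨Multiset.count_le_count_cons _ _ _, by rintro rfl; simp⟩
        | some c =>
          rw [hoi] at ho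
          have hc : q ∉ c.used := fun hqc => hq i hi ⟨c, hoi, hqc⟩
          rw [ho.2.1] at hc
          have hO : Multiset.count q O = 0 := Multiset.count_eq_zero.2 fun h => hc (.inr h)
          have h1 := congrArg (Multiset.count q) ho.2.2
          simp only [Multiset.count_add, h0 i hi, h0 (i + 1) (by omega), hO] at h1
          exact ⟨by omega, fun h => absurd (.inl h.symm) hc⟩)
    refine ⟨h1, ?_⟩
    rintro rfl i
    exact h2 (by simp [howed]) i (Nat.zero_le i)

end Trace

end OmegaPSG
end OmegaFormal

namespace OmegaFormal
namespace OmegaPSG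

variable {T : Type} {G : OmegaPSG T}

theorem limit_split {s : ℕ → List (G.N ⊕ T)} {d : ℕ → G.P} {m : ℕ → ℕ}
    {S : ℕ → List G.Fated} (h : RewritesAt s d m)
    (hS : ∀ i, ∃ N, ∀ n, N ≤ n → fates s d m n i = S i) (i : ℕ) :
    ∃ X Y Z, S (i + 1) = X ++ Y ++ Z ∧ X.length = m i ∧ Y.map Prod.fst = G.rhs (d i) ∧
      S i = X ++ (Sum.inl (G.lhsHead (d i)), comb (d i) X Y) :: Z := by
  obtain ⟨N, hN⟩ := hS i
  obtain ⟨N', hN'⟩ := hS (i + 1)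
  rw [← hN (max N N' + 1) (by omega), ← hN' (max N N') (by omega)]
  exact fates_split h _ i

/-- The start symbol of a derivation of an ω-word is not erased. -/
theorem limit_zero {π : DerivMode} {u : ℕ → T} {s : ℕ → List (G.N ⊕ T)} {d : ℕ → G.P} {m : ℕ → ℕ}
    {S : ℕ → List G.Fated} (hgen : G.Generates π u s d) (h : RewritesAt s d m)
    (hS : ∀ i, ∃ N, ∀ n, N ≤ n → fates s d m n i = S i) :
    ∃ f, S 0 = [(Sum.inl G.start, f)] ∧ (f = .lft ∨ f = .rgt) := by
  have hmark : ∀ i, List.Forall₂ Refines (mark (s i)) (S i) := fun i => by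
    obtain ⟨N, hN⟩ := hS i
    rw [← hN N le_rfl]
    exact fates_refines_of_le h (Nat.zero_le N) i
  have h0 : (S 0).map Prod.fst = [Sum.inl G.start] := by
    obtain ⟨N, hN⟩ := hS 0
    rw [← hN N le_rfl, fates_map_fst h, hgen.zero]
  obtain ⟨⟨c, f⟩, hSf, rfl : c = _⟩ := List.map_eq_singleton_iff.1 h0
  refine ⟨f, hSf, ?_⟩
  cases f with
  | lft => exact .inl rfl
  | rgt => exact .inr rfl
  | era M =>
    exfalso
    have hall : ∀ i, ∀ a ∈ S i, ∃ M, a.2 = .era M := by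
      intro i
      induction i with
      | zero => simp [hSf]
      | succ i ih =>
        obtain ⟨X, Y, Z, h1, -, -, h4⟩ := limit_split h hS i
        rw [h4] at ih
        obtain ⟨M', hM'⟩ := ih (Sum.inl (G.lhsHead (d i)), comb (d i) X Y) (by simp)
        intro a ha
        rw [h1] at ha
        simp only [List.mem_append] at ha
        rcases ha with (ha | ha) | ha
        · exact ih a (by simp [ha])
        · exact (comb_eq_era hM').2.2 a ha
        · exact ih a (by simp [ha])
    obtain ⟨i, hi⟩ := hgen.grow 1
    obtain ⟨r, hr⟩ := exists_eq_termPrefix_append (s i)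
    obtain ⟨t, z, hz⟩ := List.exists_cons_of_length_pos (l := termPrefix (s i)) (by omega)
    have hm := hmark i
    rw [hr] at hm
    obtain ⟨S', hS'⟩ := exists_eq_of_refines_mark hm
    obtain ⟨M, hM⟩ := hall i (Sum.inr t, .lft) (by simp [hS', hz])
    cases hM

/-- Removal of the steps without counterpart. -/
theorem exists_generates_of_partial {G' : OmegaPSG T} {π : DerivMode} {u : ℕ → T}
    {x : ℕ → List (G'.N ⊕ T)} {o : ℕ → Option G'.P}
    (h0 : x 0 = [Sum.inl G'.start])
    (hnone : ∀ i, o i = none → x (i + 1) = x i)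
    (hsome : ∀ i c, o i = some c → G'.StepOf π c (x i) (x (i + 1)))
    (hgrow : ∀ n, ∃ i, n ≤ (termPrefix (x i)).length)
    (hspell : ∀ i, MatchesPrefix (termPrefix (x i)) u) :
    ∃ e : ℕ → ℕ, ∃ d', StrictMono e ∧ (∀ i c, o i = some c → ∃ k, e k = i) ∧
      (∀ k, o (e k) = some (d' k)) ∧ G'.Generates π u (fun k => x (e k)) d' := by
  have hconst : ∀ i j, i ≤ j → (∀ k, i ≤ k → k < j → o k = none) → x j = x i := by
    intro i j hij hk
    induction hij with
    | refl => rfl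
    | @step j hij ih =>
      rw [hnone j (hk j hij (by simp)), ih fun k h1 h2 => hk k h1 (by simp; omega)]
  have hpre : ∀ i j, i ≤ j → termPrefix (x i) <+: termPrefix (x j) := by
    intro i j hij
    induction hij with
    | refl => exact List.prefix_rfl
    | @step j _ ih =>
      refine ih.trans ?_
      cases hoj : o j with
      | none => rw [hnone j hoj]
      | some c => exact termPrefix_prefix_of_stepOf (hsome j c hoj)
  have hinf : {i | (o i).isSome}.Infinite := by
    intro hfin
    obtain ⟨K, hK⟩ := hfin.bddAbove
    have hlate : ∀ k, K + 1 ≤ k → o k = none := by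
      intro k hk
      by_contra hne
      have := hK (a := k) (Option.isSome_iff_ne_none.2 hne)
      omega
    obtain ⟨i, hi⟩ := hgrow ((termPrefix (x (K + 1))).length + 1)
    have h1 := (hpre i (max i (K + 1)) (le_max_left _ _)).length_le
    rw [hconst (K + 1) (max i (K + 1)) (le_max_right _ _) fun k hk _ => hlate k hk] at h1
    omega
  have hmono := Nat.nth_strictMono hinf
  have hmem := Nat.nth_mem_of_infinite hinf
  have hex : ∀ i c, o i = some c → ∃ k, Nat.nth (fun i => (o i).isSome) k = i := by
    intro i c hi
    obtain ⟨k, -, hk⟩ := Nat.exists_lt_card_nth_eq (p := fun i => (o i).isSome)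
      (x := i) (by simp [hi])
    exact ⟨k, hk⟩
  generalize Nat.nth (fun i => (o i).isSome) = e at hmono hmem hex
  have hd : ∀ k, ∃ c, o (e k) = some c := fun k => Option.isSome_iff_exists.1 (hmem k)
  choose d' hd' using hd
  have hfirst : x (e 0) = x 0 := by
    refine hconst 0 (e 0) (Nat.zero_le _) fun k _ hk => ?_
    cases hok : o k with
    | none => rfl
    | some c =>
      obtain ⟨j, rfl⟩ := hex k c hok
      exact absurd (hmono.lt_iff_lt.1 hk) (Nat.not_lt_zero j)
  have hnext : ∀ k, x (e (k + 1)) = x (e k + 1) := by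
    intro k
    refine hconst (e k + 1) (e (k + 1)) (hmono (Nat.lt_succ_self k)) fun i h1 h2 => ?_
    cases hoi : o i with
    | none => rfl
    | some c =>
      obtain ⟨j, rfl⟩ := hex i c hoi
      have h1 := hmono.lt_iff_lt.1 (show e k < e j by omega)
      have h2 := hmono.lt_iff_lt.1 h2
      omega
  have hstep : ∀ k, G'.StepOf π (d' k) (x (e k)) (x (e (k + 1))) := fun k => by
    rw [hnext]
    exact hsome _ _ (hd' k)
  refine ⟨e, d', hmono, hex, hd', ⟨hfirst.trans h0, hstep, fun n => ?_, fun k => hspell _⟩⟩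
  obtain ⟨i, hi⟩ := hgrow n
  have hle : i ≤ e i := hmono.le_apply
  exact ⟨i, hi.trans (hpre _ _ hle).length_le⟩

theorem exists_lazyGrammar_generates [Finite T] (hG : G.IsCFG) {π : DerivMode} {u : ℕ → T}
    {s : ℕ → List (G.N ⊕ T)} {d : ℕ → G.P} (hgen : G.Generates π u s d) :
    ∃ s' d', G.lazyGrammar.Generates π u s' d' ∧
      ∀ σ, sigmaSet σ d = limSet σ fun k => LazyProd.used (d' k) := by
  choose x y hctx hx hx' using fun i => stepOf_iff.1 (hgen.step i)
  have h : RewritesAt s d fun i => (x i).length := fun i =>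
    ⟨x i, y i, rfl, by rw [hx i, lhs_eq_of_isCFG hG]; simp, hx' i⟩
  obtain ⟨S, hS⟩ := exists_fates_limit h
  obtain ⟨f, hf0, hf⟩ := limit_zero hgen h hS
  have hmark : ∀ i, List.Forall₂ Refines (mark (s i)) (S i) := fun i => by
    obtain ⟨N, hN⟩ := hS i
    rw [← hN N le_rfl]
    exact fates_refines_of_le h (Nat.zero_le N) i
  obtain ⟨w, o, hw0, hw⟩ := exists_seq (α := List G.Item) (β := Option G.LazyProd)
    (I := fun i w => Tidy w ∧ fated w = S i)
    (R := fun i w o w' => ItemStep π (d i) (x i).length w w' o)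
    (a := [.real (Sum.inl G.start, f) 0 false])
    ⟨⟨fun x y hxy => by
        have : Item.dead ∈ [Item.real (Sum.inl G.start, f) 0 false] := by simp [hxy]
        simp at this, by simp [Item.Fair]⟩, by simp [Item.fated, hf0]⟩ (by
      rintro i w ⟨hw, hwS⟩
      obtain ⟨X, Y, Z, h1, hXl, hY, h4⟩ := limit_split h hS i
      have hera : ∀ a ∈ Y, ∀ M, a.2 = .era M → G.Erases [a.1] M := by
        intro a ha M hM
        obtain ⟨N, hN⟩ := hS (i + 1)
        exact (fates_era hG h N (i + 1) (a := a) (by rw [hN N le_rfl, h1]; simp [ha]) hM).1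
      have hcut : Cut Y := by
        obtain ⟨N, hN⟩ := hS (i + 1)
        have := cut_fates h N (i + 1)
        rw [hN N le_rfl, h1] at this
        exact (List.pairwise_append.1 (List.pairwise_append.1 this).1).2.1
      have hπ : π = .l → ∀ a ∈ X, a.2 = .lft ∧ ∃ t, a.1 = Sum.inr t := by
        intro hl
        obtain ⟨z, hz⟩ : ∃ z : List T, x i = z.map Sum.inr := by
          have := hctx i hl
          generalize x i = x at this
          induction x with
          | nil => exact ⟨[], rfl⟩
          | cons c x ih =>
            obtain ⟨z, rfl⟩ := ih fun s hs => this s (List.mem_cons_of_mem _ hs)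
            obtain ⟨t, rfl⟩ := this c List.mem_cons_self
            exact ⟨t :: z, rfl⟩
        have hm := hmark i
        rw [hx i, hz, List.append_assoc] at hm
        obtain ⟨S', hS'⟩ := exists_eq_of_refines_mark hm
        rw [h4] at hS'
        have hXz := (List.append_inj hS' (by rw [hXl, hz]; simp)).1
        rw [hXz]
        intro a ha
        obtain ⟨t, -, rfl⟩ := List.mem_map.1 ha
        exact ⟨rfl, t, rfl⟩
      rw [← hXl]
      rw [h4] at hwS
      cases hc : comb (d i) X Y with
      | era M =>
        obtain ⟨w', hw', hstep⟩ := exists_itemStep_of_era (π := π) hw hwS hY hc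
        exact ⟨none, w', ⟨hw'.1, hw'.2.trans h1.symm⟩, hstep⟩
      | lft =>
        obtain ⟨w', c, hw', hstep⟩ :=
          exists_itemStep_of_kept hw hwS hY hcut hera hπ (.inl hc)
        exact ⟨some c, w', ⟨hw'.1, hw'.2.trans h1.symm⟩, hstep⟩
      | rgt =>
        obtain ⟨w', c, hw', hstep⟩ :=
          exists_itemStep_of_kept hw hwS hY hcut hera hπ (.inr hc)
        exact ⟨some c, w', ⟨hw'.1, hw'.2.trans h1.symm⟩, hstep⟩)
  have hnone : ∀ i, o i = none → out (w (i + 1)) = out (w i) := by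
    intro i hi
    obtain ⟨_, _, _, _, O, -, -, -, -, -, -, ho⟩ := (hw i).2
    rw [hi] at ho
    exact ho.1
  have hsome : ∀ i c, o i = some c →
      G.lazyGrammar.StepOf π c (out (w i)) (out (w (i + 1))) := by
    intro i c hi
    obtain ⟨_, _, _, _, O, -, -, -, -, -, -, ho⟩ := (hw i).2
    rw [hi] at ho
    exact ho.1
  have hspell := spells_of_dominated (f := fun i => termPrefix (s i))
    (g := fun i => termPrefix (out (w i))) (u := u) (fun i => by
      cases hi : o i with
      | none => rw [hnone i hi]
      | some c => exact termPrefix_prefix_of_stepOf (hsome i c hi))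
    (fun i => ⟨i, (hw i).1.1.termPrefix_mono ((hw i).1.2 ▸ hmark i)⟩) hgen.grow hgen.spell
  have hout0 : out (w 0) = [Sum.inl (some (G.start, ∅, false))] := by
    rw [hw0]
    rcases hf with rfl | rfl <;> simp [Item.out]
  obtain ⟨e, d', hmono, hex, hd', hgen'⟩ := exists_generates_of_partial
    (G' := G.lazyGrammar) hout0 hnone hsome hspell.1 hspell.2
  refine ⟨_, d', hgen', fun σ => ?_⟩
  rw [sigmaSet_eq_limSet_claimed hG h hS (fun i => (hw i).1) (fun i => (hw i).2)
    (by simp [hw0, Item.pend]) (by rcases hf with rfl | rfl <;> simp [hw0, Item.fated, Fate.prods])]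
  have hclaim : ∀ k, claimed o (e k) = LazyProd.used (d' k) := by
    intro k
    ext q
    constructor
    · rintro ⟨c, hc, hq⟩
      rw [hd' k] at hc
      cases hc
      exact hq
    · exact fun hq => ⟨d' k, hd' k, hq⟩
  ext q
  cases σ with
  | ran =>
    constructor
    · rintro ⟨i, c, hc, hq⟩
      obtain ⟨k, rfl⟩ := hex i c hc
      exact ⟨k, (hclaim k).subset ⟨c, hc, hq⟩⟩
    · rintro ⟨k, hk⟩
      exact ⟨e k, (hclaim k).symm ▸ hk⟩
  | inf =>
    constructor
    · intro hq n
      obtain ⟨i, hi, c, hc, hq⟩ := hq (e n)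
      obtain ⟨k, rfl⟩ := hex i c hc
      exact ⟨k, hmono.le_iff_le.1 hi, (hclaim k).subset ⟨c, hc, hq⟩⟩
    · intro hq n
      obtain ⟨k, hk, hq⟩ := hq n
      exact ⟨e k, hk.trans hmono.le_apply, (hclaim k).symm ▸ hq⟩

end OmegaPSG
end OmegaFormal

namespace OmegaFormal
namespace OmegaPSG

variable {T : Type} {G : OmegaPSG T}

theorem eventually_eq_of_sigmaSet_subset {Q : Type*} [Finite Q] {σ : AccSigma} {f : ℕ → Q} {c : Q}
    (h : sigmaSet σ f ⊆ {c}) : ∃ t, ∀ i, t ≤ i → f i = c := by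
  cases σ with
  | ran => exact ⟨0, fun i _ => h ⟨i, rfl⟩⟩
  | inf =>
    by_contra! hc
    have hq : () ∈ limSet .inf (fun i => {_x : Unit | f i ≠ c}) := hc
    rw [limSet_eq_biUnion .inf f fun q => {_x : Unit | q ≠ c}] at hq
    simp only [Set.mem_iUnion] at hq
    obtain ⟨q, hq, hne⟩ := hq
    exact hne (h hq)

/-- No production of the ε-free grammar can be applied forever on its own, because the rewritten
nonterminal does not have the same parity as those on the right-hand side. -/
theorem not_sigmaSet_subset_singleton [Finite T] {π : DerivMode}
    {s : ℕ → List (G.LazyN ⊕ T)} {d : ℕ → G.LazyProd}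
    (h : ∀ i, G.lazyGrammar.StepOf π (d i) (s i) (s (i + 1))) (σ : AccSigma) (c : G.LazyProd) :
    ¬ sigmaSet σ d ⊆ {c} := by
  classical
  intro hc
  have := G.finite_lazyProd
  obtain ⟨t, ht⟩ := eventually_eq_of_sigmaSet_subset hc
  let same : G.LazyN ⊕ T → Bool := fun a => decide (∃ A R, a = Sum.inl (some (A, R, c.parity)))
  have hdec : ∀ i, t ≤ i → (s (i + 1)).countP same < (s i).countP same := by
    intro i hi
    obtain ⟨u, v, hx, hy⟩ : ∃ u v : List (G.LazyN ⊕ T),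
        s i = u ++ [Sum.inl (some (G.lhsHead c.prod, c.promised, c.parity))] ++ v ∧
        s (i + 1) = u ++ c.body ++ v := by
      obtain ⟨u, v, -, h⟩ := stepOf_iff.1 (ht i hi ▸ h i)
      exact ⟨u, v, h⟩
    have hbody : c.body.countP same = 0 := by
      rw [List.countP_eq_zero]
      intro a ha hsame
      obtain ⟨A, R, rfl⟩ := of_decide_eq_true hsame
      exact c.parity_ne A R _ ha rfl
    have hhead : same (Sum.inl (some (G.lhsHead c.prod, c.promised, c.parity))) = true :=
      decide_eq_true ⟨_, _, rfl⟩
    rw [hx, hy]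
    simp only [List.countP_append, List.countP_singleton, hhead, hbody, if_true]
    omega
  obtain ⟨⟨t', ht'⟩, -⟩ := exists_last_event (Φ := fun i => (s i).countP same)
    (E := fun _ => True) (t := t) fun i hi => ⟨(hdec i hi).le, fun _ => hdec i hi⟩
  exact ht' t' le_rfl trivial

theorem lazy_of_kept (y : List (G.N ⊕ T)) :
    G.Lazy ∅ ∅ (y.map (Sum.map (fun A => some (A, ∅, true)) id)) y := by
  induction y with
  | nil => exact .nil
  | cons a y ih =>
    cases a with
    | inl A => exact .kept A true ih
    | inr a => exact .term a ih

theorem exists_lazyProd_used_eq (p : G.P) : ∃ c : G.LazyProd, c.used = {p} := by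
  refine ⟨⟨p, ∅, false, ∅,
    Sum.inl none :: (G.rhs p).map (Sum.map (fun A => some (A, ∅, true)) id),
    .dead (lazy_of_kept _), List.cons_ne_nil _ _, by simp, ?_⟩, by simp [LazyProd.used]⟩
  rintro A R b hb
  simp only [List.mem_cons, List.mem_map, Sum.inl.injEq, reduceCtorEq, false_or] at hb
  obtain ⟨a | a, -, ha⟩ := hb
  · simp only [Sum.map_inl, Sum.inl.injEq, Option.some.injEq, Prod.mk.injEq] at ha
    simp [← ha.2.2]
  · simp at ha

theorem exists_acc_iff_lazyGrammar [Finite T] {D : Set G.LazyProd} (hD : ∀ c, ¬ D ⊆ {c})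
    (ρ : AccRho) : (∃ F ∈ G.acc, rhoRel ρ (⋃ c ∈ D, c.used) F) ↔
      ∃ H ∈ G.lazyGrammar.acc, rhoRel ρ D H := by
  cases ρ with
  | cap =>
    constructor
    · rintro ⟨F, hF, q, hq, hqF⟩
      simp only [Set.mem_iUnion] at hq
      obtain ⟨c, hc, hq⟩ := hq
      exact ⟨{c}, .inr ⟨c, ⟨q, hq, F, hF, hqF⟩, rfl⟩, c, hc, rfl⟩
    · rintro ⟨H, hH | ⟨c, ⟨q, hq, F, hF, hqF⟩, rfl⟩, c', hc', hcH⟩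
      · exact ⟨_, hH, c'.prod, Set.mem_biUnion hc' (Set.mem_insert _ _),
          Set.mem_biUnion hcH (Set.mem_insert _ _)⟩
      · cases hcH
        exact ⟨F, hF, q, Set.mem_biUnion hc' hq, hqF⟩
  | sub =>
    constructor
    · rintro ⟨F, hF, hsub⟩
      refine ⟨{c : G.LazyProd | c.used ⊆ F}, .inl ?_, Set.iUnion₂_subset_iff.1 hsub⟩
      suffices h : ⋃ c ∈ {c : G.LazyProd | c.used ⊆ F}, c.used = F from
        Set.mem_ofPred_eq ▸ h.symm ▸ hF
      refine Set.Subset.antisymm (Set.iUnion₂_subset fun c hc => hc) fun p hp => ?_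
      obtain ⟨c, hc⟩ := exists_lazyProd_used_eq p
      exact Set.mem_biUnion (x := c) (by simpa [hc] using hp) (by simp [hc])
    · rintro ⟨H, hH | ⟨c, -, rfl⟩, hsub⟩
      · exact ⟨_, hH, Set.biUnion_subset_biUnion_left hsub⟩
      · exact (hD c hsub).elim
  | eq =>
    constructor
    · rintro ⟨F, hF, rfl⟩
      exact ⟨D, .inl hF, rfl⟩
    · rintro ⟨H, hH | ⟨c, -, rfl⟩, hsub⟩
      · cases hsub
        exact ⟨_, hH, rfl⟩
      · exact (hD c (Eq.subset hsub)).elim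

theorem mem_lang_iff {σ : AccSigma} {ρ : AccRho} {π : DerivMode} {u : ℕ → T} :
    u ∈ G.Lang σ ρ π ↔ ∃ s d, G.Generates π u s d ∧ IsAccepting σ ρ G.acc d :=
  ⟨fun ⟨s, d, h0, h1, h2, h3, h⟩ => ⟨s, d, ⟨h0, h1, h2, h3⟩, h⟩,
    fun ⟨s, d, ⟨h0, h1, h2, h3⟩, h⟩ => ⟨s, d, h0, h1, h2, h3, h⟩⟩

theorem lang_lazyGrammar [Finite T] (hG : G.IsCFG) (σ : AccSigma) (ρ : AccRho) (π : DerivMode) :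
    G.lazyGrammar.Lang σ ρ π = G.Lang σ ρ π := by
  have := G.finite_lazyProd
  have key : ∀ {s' : ℕ → List (G.LazyN ⊕ T)} {d' : ℕ → G.LazyProd} {d : ℕ → G.P} {u : ℕ → T},
      G.lazyGrammar.Generates π u s' d' →
      sigmaSet σ d = limSet σ (fun k => (d' k).used) →
      (IsAccepting σ ρ G.acc d ↔ IsAccepting σ ρ G.lazyGrammar.acc d') := by
    intro s' d' d u h hd
    rw [limSet_eq_biUnion σ d' LazyProd.used] at hd
    rw [IsAccepting, hd]
    exact exists_acc_iff_lazyGrammar (not_sigmaSet_subset_singleton h.step σ) ρ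
  ext u
  rw [mem_lang_iff, mem_lang_iff]
  constructor
  · rintro ⟨s', d', h', hacc⟩
    obtain ⟨s, d, h, hd⟩ := exists_generates_of_lazyGrammar hG h'
    exact ⟨s, d, h, (key h' (hd σ)).2 hacc⟩
  · rintro ⟨s, d, h, hacc⟩
    obtain ⟨s', d', h', hd⟩ := exists_lazyGrammar_generates hG h
    exact ⟨s', d', h', (key h' (hd σ)).1 hacc⟩

end OmegaPSG
end OmegaFormal

open OmegaFormal

/-- Lemma: every ω-CFG G has an ε-production-free ω-CFG G' that is
(σ,ρ,π)-equivalent to it for every (σ,ρ,π) ∉ {(ran,⊓,l), (ran,=,l)}. -/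
theorem cfg_eps_free (T : Type) [Fintype T] (G : OmegaPSG T) (hG : G.IsCFG) :
    ∃ G' : OmegaPSG T, G'.IsCFG ∧ (∀ p : G'.P, G'.rhs p ≠ []) ∧
      ∀ (σ : AccSigma) (ρ : AccRho) (π : DerivMode),
        (σ, ρ, π) ≠ (AccSigma.ran, AccRho.cap, DerivMode.l) →
        (σ, ρ, π) ≠ (AccSigma.ran, AccRho.eq, DerivMode.l) →
        G.Lang σ ρ π = G'.Lang σ ρ π := by
  exact ⟨G.lazyGrammar, fun _ => rfl, fun c => c.body_ne,
    fun σ ρ π _ _ => (OmegaPSG.lang_lazyGrammar hG σ ρ π).symm⟩
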